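/- Let F_q be a fixed finite field of odd cardinality q, and let F be a monic polynomial in F_q[t] of degree n ≥ 2. Then there exists s₀ such that for every s ≥ s₀ and every finite field K containing F_q with #K = q^s, the image of F in K[t] has a Goldbach representation in K[t]: there exist monic irreducible F₁, F₂ ∈ K[t] with deg F₁ = n−1, deg F₂ = n, and F = F₁ + F₂. -/

import Mathlib

open Polynomial

set_option linter.unusedSectionVars false

namespace Goldbach

section DegreeFiltration

variable {k R ι : Type*} [Field k] [CommRing R] [Algebra k[X] R] [Algebra k R]
  [IsScalarTower k k[X] R]

/-- The elements of a free `k[X]`-algebra whose coordinates have degree at most `d`. -/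
def degreeLE (e : Module.Basis ι k[X] R) (d : ℕ) : Submodule k R where
  carrier := {x | ∀ i, (e.repr x i).natDegree ≤ d}
  add_mem' {x y} hx hy i := by
    rw [map_add]
    exact (natDegree_add_le _ _).trans (max_le (hx i) (hy i))
  zero_mem' i := by simp
  smul_mem' c x hx i := by
    rw [← algebraMap_smul k[X] c x, map_smul, Finsupp.smul_apply, smul_eq_mul]
    exact (natDegree_C_mul_le c _).trans (hx i)

theorem degreeLE_mono (e : Module.Basis ι k[X] R) {a b : ℕ} (h : a ≤ b) :
    degreeLE e a ≤ degreeLE e b := fun _ hx i => (hx i).trans h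

theorem smul_mem_degreeLE {e : Module.Basis ι k[X] R} {d a : ℕ} {x : R} {p : k[X]}
    (hp : p.natDegree ≤ a) (hx : x ∈ degreeLE e d) : p • x ∈ degreeLE e (d + a) := fun i => by
  rw [map_smul, Finsupp.smul_apply, smul_eq_mul, add_comm]
  exact natDegree_mul_le.trans (add_le_add hp (hx i))

theorem basis_mem_degreeLE (e : Module.Basis ι k[X] R) (i : ι) : e i ∈ degreeLE e 0 := by
  classical
  intro j
  rw [e.repr_self, Finsupp.single_apply]
  split_ifs <;> simp

theorem exists_mem_degreeLE [Finite ι] (e : Module.Basis ι k[X] R) {κ : Type*} [Finite κ]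
    (x : κ → R) : ∃ C, ∀ j, x j ∈ degreeLE e C := by
  have := Fintype.ofFinite ι
  have := Fintype.ofFinite κ
  refine ⟨∑ j, ∑ i, (e.repr (x j) i).natDegree, fun j i => ?_⟩
  exact (Finset.single_le_sum (f := fun i => (e.repr (x j) i).natDegree)
    (fun _ _ => Nat.zero_le _) (Finset.mem_univ i)).trans
    (Finset.single_le_sum (f := fun j => ∑ i, (e.repr (x j) i).natDegree)
      (fun _ _ => Nat.zero_le _) (Finset.mem_univ j))

/-- Multiplication raises the degree of coordinates by at most `C`. -/
def MulBound (e : Module.Basis ι k[X] R) (C : ℕ) : Prop :=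
  ∀ ⦃a b : ℕ⦄ ⦃x y : R⦄, x ∈ degreeLE e a → y ∈ degreeLE e b → x * y ∈ degreeLE e (a + b + C)

theorem MulBound.mono {e : Module.Basis ι k[X] R} {C D : ℕ} (h : MulBound e C) (hCD : C ≤ D) :
    MulBound e D := fun _ _ _ _ hx hy => degreeLE_mono e (by omega) (h hx hy)

theorem exists_mulBound [Finite ι] (e : Module.Basis ι k[X] R) : ∃ C, MulBound e C := by
  have := Fintype.ofFinite ι
  obtain ⟨C, hC⟩ := exists_mem_degreeLE e (fun j : ι × ι => e j.1 * e j.2)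
  refine ⟨C, fun a b x y hx hy => ?_⟩
  rw [← e.sum_repr x, ← e.sum_repr y, Finset.sum_mul_sum]
  refine Submodule.sum_mem _ fun i _ => Submodule.sum_mem _ fun j _ => ?_
  rw [smul_mul_smul_comm, add_comm]
  exact smul_mem_degreeLE (natDegree_mul_le.trans (add_le_add (hx i) (hy j))) (hC (i, j))

theorem MulBound.pow_mem {e : Module.Basis ι k[X] R} {C : ℕ} (h : MulBound e C) {a : ℕ} {x : R}
    (hx : x ∈ degreeLE e a) {j : ℕ} (hj : 1 ≤ j) : x ^ j ∈ degreeLE e (j * (a + C)) := by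
  induction j, hj using Nat.le_induction with
  | base => simpa using degreeLE_mono e (by omega) hx
  | succ j _ ih =>
    rw [pow_succ]
    exact degreeLE_mono e (by ring_nf; omega) (h ih hx)

section Finrank

variable [IsDomain R] [Fintype ι]

theorem finite_quotient_span (e : Module.Basis ι k[X] R) {y : R} (hy : y ≠ 0) :
    Module.Finite k (R ⧸ Ideal.span {y}) := by
  have h : Ideal.span {y} ≠ ⊥ := Ideal.span_singleton_eq_bot.not.2 hy
  exact Module.Finite.equiv (Ideal.quotientEquivDirectSum k e h).symm

theorem finrank_quotient_span_le {e : Module.Basis ι k[X] R} {C d : ℕ} (hC : MulBound e C) {y : R}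
    (hy : y ≠ 0) (hd : y ∈ degreeLE e d) :
    Module.finrank k (R ⧸ Ideal.span {y}) ≤ Fintype.card ι * (d + C) := by
  classical
  rw [finrank_quotient_span_eq_natDegree_norm e hy, Algebra.norm_eq_matrix_det e, Matrix.det_apply]
  refine natDegree_sum_le_of_forall_le _ _ fun σ _ => ?_
  refine (natDegree_smul_le _ _).trans ((natDegree_prod_le _ _).trans ?_)
  refine (Finset.sum_le_card_nsmul _ _ (d + C) fun i _ => ?_).trans (by simp)
  rw [Algebra.leftMulMatrix_eq_repr_mul]
  simpa using hC hd (basis_mem_degreeLE e i) (σ i)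

theorem finrank_quotient_span_algebraMap (e : Module.Basis ι k[X] R) (a : k) :
    Module.finrank k (R ⧸ Ideal.span {algebraMap k[X] R (X - C a)}) = Fintype.card ι := by
  have : Module.Free k[X] R := Module.Free.of_basis e
  have hy : algebraMap k[X] R (X - C a) ≠ 0 := by
    rw [Ne, FaithfulSMul.algebraMap_eq_zero_iff]
    exact X_sub_C_ne_zero a
  rw [finrank_quotient_span_eq_natDegree_norm e hy, Algebra.norm_algebraMap_of_basis e]
  simp

/-- The points at which a nonzero element vanishes. -/
theorem card_le_finrank_quotient_span (e : Module.Basis ι k[X] R) {y : R} (hy : y ≠ 0)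
    (S : Finset (R →ₐ[k] k)) (hS : ∀ P ∈ S, P y = 0) :
    S.card ≤ Module.finrank k (R ⧸ Ideal.span {y}) := by
  have := finite_quotient_span e hy
  refine le_trans ?_ (card_algHom_le_finrank k (R ⧸ Ideal.span {y}) k)
  have hker : ∀ P ∈ S, ∀ x ∈ Ideal.span {y}, P x = 0 := fun P hP x hx => by
    obtain ⟨z, rfl⟩ := Ideal.mem_span_singleton'.1 hx
    rw [map_mul, hS P hP, mul_zero]
  rw [← Nat.card_eq_finsetCard S]
  refine Nat.card_le_card_of_injective
    (fun P : S => Ideal.Quotient.liftₐ (Ideal.span {y}) P.1 (hker P.1 P.2)) fun P P' h => ?_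
  refine Subtype.ext (AlgHom.ext fun x => ?_)
  exact DFunLike.congr_fun h (Ideal.Quotient.mk _ x)

/-- The value at `X` of a point. -/
noncomputable def base (P : R →ₐ[k] k) : k := P (algebraMap k[X] R X)

theorem apply_algebraMap (P : R →ₐ[k] k) (p : k[X]) :
    P (algebraMap k[X] R p) = p.eval (base P) := by
  have h : P.comp (IsScalarTower.toAlgHom k k[X] R) = aeval (base P) :=
    Polynomial.algHom_ext (by simp [base])
  have := DFunLike.congr_fun h p
  simpa [coe_aeval_eq_eval] using this

/-- The action of automorphisms on points. -/
noncomputable def twist (P : R →ₐ[k] k) (σ : R ≃ₐ[k[X]] R) : R →ₐ[k] k :=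
  P.comp ((σ : R →ₐ[k[X]] R).restrictScalars k)

@[simp]
theorem twist_apply (P : R →ₐ[k] k) (σ : R ≃ₐ[k[X]] R) (x : R) : twist P σ x = P (σ x) := rfl

@[simp]
theorem base_twist (P : R →ₐ[k] k) (σ : R ≃ₐ[k[X]] R) : base (twist P σ) = base P := by
  simp [base]

theorem ker_ne_bot (e : Module.Basis ι k[X] R) (P : R →ₐ[k] k) : RingHom.ker P ≠ ⊥ := by
  have : Module.Free k[X] R := Module.Free.of_basis e
  intro h
  have h1 : algebraMap k[X] R (X - C (base P)) ∈ RingHom.ker P := by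
    rw [RingHom.mem_ker, apply_algebraMap]
    simp
  rw [h, Ideal.mem_bot, FaithfulSMul.algebraMap_eq_zero_iff] at h1
  exact X_sub_C_ne_zero _ h1

theorem ker_pow_succ_lt (e : Module.Basis ι k[X] R) (P : R →ₐ[k] k) (j : ℕ) :
    RingHom.ker P ^ (j + 1) < RingHom.ker P ^ j := by
  have : Module.Finite k[X] R := Module.Finite.of_basis e
  have : IsNoetherianRing R := IsNoetherianRing.of_finite k[X] R
  have hbot := ker_ne_bot e P
  refine lt_of_le_of_ne (Ideal.pow_le_pow_right (Nat.le_succ j)) fun h => ?_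
  have hconst : ∀ i, RingHom.ker P ^ (j + i) = RingHom.ker P ^ j := fun i => by
    induction i with
    | zero => rfl
    | succ i ih => rw [← add_assoc, pow_succ, ih, ← pow_succ, h]
  have hle : RingHom.ker P ^ j ≤ ⨅ i : ℕ, RingHom.ker P ^ i := le_iInf fun i => by
    rw [← hconst i]
    exact Ideal.pow_le_pow_right (Nat.le_add_left i j)
  rw [Ideal.iInf_pow_eq_bot_of_isDomain _ (RingHom.ker_ne_top _), le_bot_iff] at hle
  exact pow_ne_zero j hbot hle

theorem le_finrank_of_mem_ker_pow (e : Module.Basis ι k[X] R) {y : R} (hy : y ≠ 0)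
    (P : R →ₐ[k] k) {Q : ℕ} (hQ : y ∈ RingHom.ker P ^ Q) :
    Q ≤ Module.finrank k (R ⧸ Ideal.span {y}) := by
  have := finite_quotient_span e hy
  let I : ℕ → Submodule k (R ⧸ Ideal.span {y}) := fun j =>
    ((RingHom.ker P ^ j).map (Ideal.Quotient.mk (Ideal.span {y}))).restrictScalars k
  have hlt : ∀ j < Q, I (j + 1) < I j := fun j hj => by
    refine lt_of_le_of_ne (Ideal.map_mono (Ideal.pow_le_pow_right (Nat.le_succ j))) fun h => ?_
    have h' : (RingHom.ker P ^ (j + 1)).map (Ideal.Quotient.mk (Ideal.span {y})) =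
        (RingHom.ker P ^ j).map (Ideal.Quotient.mk (Ideal.span {y})) :=
      Submodule.restrictScalars_injective k _ _ h
    have hcomap : ∀ i ≤ Q, ((RingHom.ker P ^ i).map (Ideal.Quotient.mk (Ideal.span {y}))).comap
        (Ideal.Quotient.mk (Ideal.span {y})) = RingHom.ker P ^ i := fun i hi => by
      rw [Ideal.comap_map_of_surjective' _ Ideal.Quotient.mk_surjective, Ideal.mk_ker, sup_eq_left,
        Ideal.span_singleton_le_iff_mem]
      exact Ideal.pow_le_pow_right hi hQ
    have := congrArg (Ideal.comap (Ideal.Quotient.mk (Ideal.span {y}))) h'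
    rw [hcomap _ hj, hcomap _ hj.le] at this
    exact (ker_pow_succ_lt e P j).ne this
  have hge : ∀ i ≤ Q, i ≤ Module.finrank k (I (Q - i)) := fun i => by
    induction i with
    | zero => simp
    | succ i ih =>
      intro hi
      have h1 := Submodule.finrank_lt_finrank_of_lt (hlt (Q - (i + 1)) (by omega))
      rw [show Q - (i + 1) + 1 = Q - i by omega] at h1
      exact (ih (by omega)).trans_lt h1
  exact (hge Q le_rfl).trans (Submodule.finrank_le _)

theorem exists_point [IsAlgClosed k] (e : Module.Basis ι k[X] R) (a : k) :
    ∃ P : R →ₐ[k] k, base P = a := by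
  have : Module.Free k[X] R := Module.Free.of_basis e
  have : Nonempty ι := e.index_nonempty
  have hy : algebraMap k[X] R (X - C a) ≠ 0 := by
    rw [Ne, FaithfulSMul.algebraMap_eq_zero_iff]
    exact X_sub_C_ne_zero a
  have hfin := finite_quotient_span e hy
  have hpos : 0 < Module.finrank k (R ⧸ Ideal.span {algebraMap k[X] R (X - C a)}) := by
    rw [finrank_quotient_span_algebraMap e]
    exact Fintype.card_pos
  have hnt : Nontrivial (R ⧸ Ideal.span {algebraMap k[X] R (X - C a)}) :=
    Module.nontrivial_of_finrank_pos hpos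
  obtain ⟨M, hM⟩ := Ideal.exists_maximal (R ⧸ Ideal.span {algebraMap k[X] R (X - C a)})
  have : Module.Finite k ((R ⧸ Ideal.span {algebraMap k[X] R (X - C a)}) ⧸ M) :=
    Module.Finite.of_surjective (Ideal.Quotient.mkₐ k M).toLinearMap Ideal.Quotient.mk_surjective
  let φ : ((R ⧸ Ideal.span {algebraMap k[X] R (X - C a)}) ⧸ M) →ₐ[k] k := IsAlgClosed.lift
  let P : R →ₐ[k] k := (φ.comp (Ideal.Quotient.mkₐ k M)).comp (Ideal.Quotient.mkₐ k _)
  refine ⟨P, ?_⟩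
  have h0 : P (algebraMap k[X] R (X - C a)) = 0 := by
    have : Ideal.Quotient.mkₐ k (Ideal.span {algebraMap k[X] R (X - C a)})
        (algebraMap k[X] R (X - C a)) = 0 :=
      Ideal.Quotient.eq_zero_iff_mem.2 (Ideal.mem_span_singleton_self _)
    simp only [P, AlgHom.comp_apply, this, map_zero]
  rw [apply_algebraMap] at h0
  simpa [sub_eq_zero] using h0

end Finrank
end DegreeFiltration

section Stepanov

variable {k R ι : Type*} [Field k] [CommRing R] [Algebra k[X] R] [Algebra k R]
  [IsScalarTower k k[X] R] [IsDomain R] [Fintype ι] [IsAlgClosed k]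

theorem exists_point_ne_zero (e : Module.Basis ι k[X] R) {G : R} (hG : G ≠ 0) :
    ∃ P : R →ₐ[k] k, P G ≠ 0 := by
  by_contra! h
  have hinf : Infinite (R →ₐ[k] k) := by
    have := IsAlgClosed.instInfinite (K := k)
    exact Infinite.of_surjective (base (R := R)) (exists_point e)
  obtain ⟨S, hS⟩ := Infinite.exists_subset_card_eq (R →ₐ[k] k)
    (Module.finrank k (R ⧸ Ideal.span {G}) + 1)
  have := card_le_finrank_quotient_span e hG S fun P _ => h P
  omega

theorem exists_relation (e : Module.Basis ι k[X] R) {α : Type*} [Fintype α] {D : ℕ} (z : α → R)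
    (hz : ∀ j, z j ∈ degreeLE e D) (hcard : Fintype.card ι * (D + 1) < Fintype.card α) :
    ∃ d : α → k, d ≠ 0 ∧ ∑ j, d j • z j = 0 := by
  let T : (α → k) →ₗ[k] (ι × Fin (D + 1) → k) :=
    LinearMap.pi fun x => ∑ j, ((e.repr (z j) x.1).coeff x.2) • LinearMap.proj j
  have hT : LinearMap.ker T ≠ ⊥ := T.ker_ne_bot_of_finrank_lt (by simpa using hcard)
  obtain ⟨d, hd, hd0⟩ := Submodule.exists_mem_ne_zero_of_ne_bot hT
  refine ⟨d, hd0, e.repr.injective (Finsupp.ext fun i => Polynomial.ext fun n => ?_)⟩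
  have hmem : ∑ j, d j • z j ∈ degreeLE e D :=
    Submodule.sum_mem _ fun j _ => Submodule.smul_mem _ _ (hz j)
  rw [map_zero, Finsupp.zero_apply, coeff_zero]
  rcases lt_or_ge D n with hn | hn
  · exact coeff_eq_zero_of_natDegree_lt ((hmem i).trans_lt hn)
  · have := congrFun (LinearMap.mem_ker.1 hd) (i, ⟨n, Nat.lt_succ_of_le hn⟩)
    simp only [T, LinearMap.pi_apply, LinearMap.sum_apply, LinearMap.smul_apply,
      LinearMap.proj_apply, Pi.zero_apply, smul_eq_mul] at this
    rw [← this, map_sum, Finsupp.finsetSum_apply, finsetSum_coeff]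
    refine Finset.sum_congr rfl fun j _ => ?_
    rw [← algebraMap_smul k[X] (d j), map_smul, Finsupp.smul_apply, smul_eq_mul, mul_comm]
    exact coeff_mul_C _ _ _

variable {p : ℕ} [Fact p.Prime] [CharP k p] {α β : Type*} [Fintype α] [Fintype β]

theorem sum_mul_pow_ne_zero {e : Module.Basis ι k[X] R} {C L ν : ℕ} (hC : MulBound e C)
    {φ : α → R} {g : β → R} (hφ : LinearIndependent k φ) (hg : LinearIndependent k g)
    (hφL : ∀ i, φ i ∈ degreeLE e L) (hQ : Fintype.card ι * (L + C) < p ^ ν)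
    {c : α × β → k} (hc : c ≠ 0) : ∑ x, c x • (φ x.1 * g x.2 ^ p ^ ν) ≠ 0 := by
  have : FaithfulSMul k R := inferInstance
  have : CharP R p := charP_of_injective_algebraMap (FaithfulSMul.algebraMap_injective k R) p
  have hp : 0 < p ^ ν := pow_pos (Fact.out : p.Prime).pos ν
  choose γ hγ using fun x => IsAlgClosed.exists_pow_nat_eq (c x) hp
  let G : α → R := fun i => ∑ j, γ (i, j) • g j
  have hGpow : ∀ i, G i ^ p ^ ν = ∑ j, c (i, j) • g j ^ p ^ ν := fun i => by
    simp only [G, sum_pow_char_pow, _root_.smul_pow, hγ]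
  have hsum : ∑ x, c x • (φ x.1 * g x.2 ^ p ^ ν) = ∑ i, φ i * G i ^ p ^ ν := by
    simp only [hGpow, Fintype.sum_prod_type, Finset.mul_sum, mul_smul_comm]
  obtain ⟨⟨i₀, j₀⟩, hx⟩ := Function.ne_iff.1 hc
  have hG : G i₀ ≠ 0 := fun h => by
    have := Fintype.linearIndependent_iff.1 hg (fun j => γ (i₀, j)) h j₀
    rw [Pi.zero_apply, ← hγ, this, zero_pow hp.ne'] at hx
    exact hx rfl
  obtain ⟨P, hP⟩ := exists_point_ne_zero e hG
  set y : R := ∑ i, (P (G i)) ^ p ^ ν • φ i with hy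
  have hy0 : y ≠ 0 := fun h =>
    pow_ne_zero _ hP (Fintype.linearIndependent_iff.1 hφ (fun i => P (G i) ^ p ^ ν) h i₀)
  have hyL : y ∈ degreeLE e L :=
    Submodule.sum_mem _ fun i _ => Submodule.smul_mem _ _ (hφL i)
  intro h0
  have hyQ : y ∈ RingHom.ker P ^ p ^ ν := by
    have : y = -∑ i, φ i * (G i - algebraMap k R (P (G i))) ^ p ^ ν := by
      have hexp : ∀ i, φ i * (G i - algebraMap k R (P (G i))) ^ p ^ ν =
          φ i * G i ^ p ^ ν - P (G i) ^ p ^ ν • φ i := fun i => by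
        rw [sub_pow_char_pow, mul_sub, Algebra.smul_def, map_pow, mul_comm (algebraMap k R _ ^ _)]
      rw [Finset.sum_congr rfl fun i _ => hexp i, Finset.sum_sub_distrib, ← hsum, h0, ← hy]
      ring
    rw [this]
    refine neg_mem (Ideal.sum_mem _ fun i _ => Ideal.mul_mem_left _ _ (Ideal.pow_mem_pow ?_ _))
    rw [RingHom.mem_ker]
    simp
  have h1 := le_finrank_of_mem_ker_pow e hy0 P hyQ
  have h2 := finrank_quotient_span_le hC hy0 hyL
  omega

theorem card_points_le_aux {e : Module.Basis ι k[X] R} {C L N μ ν : ℕ} (hC : MulBound e C)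
    {φ : α → R} {g g' : β → R} (hφ : LinearIndependent k φ) (hg : LinearIndependent k g)
    (hφL : ∀ i, φ i ∈ degreeLE e L) (hgN : ∀ j, g j ∈ degreeLE e N)
    (hgN' : ∀ j, g' j ∈ degreeLE e N) (hQ : Fintype.card ι * (L + C) < p ^ ν)
    (hcard : Fintype.card ι * (p ^ μ * (L + C) + N + C + 1) < Fintype.card α * Fintype.card β)
    (S : Finset (R →ₐ[k] k)) (hS : ∀ P ∈ S, ∀ j, P (g j) ^ p ^ (μ + ν) = P (g' j)) :
    S.card ≤ Fintype.card ι * (L + p ^ ν * (N + C) + 2 * C) := by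
  have hpos : ∀ a, 0 < p ^ a := fun a => pow_pos (Fact.out : p.Prime).pos a
  obtain ⟨d, hd0, hd⟩ := exists_relation e (fun x : α × β => φ x.1 ^ p ^ μ * g' x.2)
    (fun x => hC (hC.pow_mem (hφL x.1) (hpos μ)) (hgN' x.2)) (by simpa using hcard)
  choose c hc using fun x => IsAlgClosed.exists_pow_nat_eq (d x) (hpos μ)
  have hc0 : c ≠ 0 := by
    rintro rfl
    refine hd0 (funext fun x => ?_)
    rw [← hc x]
    simp [(Fact.out : p.Prime).ne_zero]
  have hs0 := sum_mul_pow_ne_zero hC hφ hg hφL hQ hc0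
  set s := ∑ x, c x • (φ x.1 * g x.2 ^ p ^ ν) with hs
  have hsD : s ∈ degreeLE e (L + p ^ ν * (N + C) + C) :=
    Submodule.sum_mem _ fun x _ => Submodule.smul_mem _ _
      (hC (hφL x.1) (hC.pow_mem (hgN x.2) (hpos ν)))
  refine (card_le_finrank_quotient_span e hs0 S fun P hP => ?_).trans
    ((finrank_quotient_span_le hC hs0 hsD).trans (le_of_eq (by ring)))
  refine eq_zero_of_pow_eq_zero (n := p ^ μ) ?_
  have := congrArg P hd
  rw [map_sum, map_zero] at this
  rw [hs, map_sum, sum_pow_char_pow, ← this]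
  refine Finset.sum_congr rfl fun x _ => ?_
  rw [map_smul, map_smul, smul_eq_mul, smul_eq_mul, mul_pow, hc, map_mul, map_mul, mul_pow, map_pow,
    map_pow, ← pow_mul, ← pow_add, add_comm ν μ, hS P hP]

theorem linearIndependent_X_pow_smul {κ : Type*} {w : κ → R} (hw : LinearIndependent k[X] w)
    (L : ℕ) : LinearIndependent k fun x : Fin L × κ => (X ^ (x.1 : ℕ) : k[X]) • w x.2 := by
  refine linearIndependent_smul (b := fun a : Fin L => (X ^ (a : ℕ) : k[X])) ?_ hw
  have := (Polynomial.basisMonomials k).linearIndependent.comp (fun a : Fin L => (a : ℕ))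
    Fin.val_injective
  convert this using 2 with a
  simp [X_pow_eq_monomial]

/-- **Stepanov–Bombieri bound**: the number of points at which the `p ^ (μ + ν)`-power map takes
the value of `w` to the value of `w'`. -/
theorem card_points_le {e : Module.Basis ι k[X] R} {C μ ν : ℕ} (hC : MulBound e C)
    {w w' : ι → R} (hw : LinearIndependent k[X] w) (hwC : ∀ i, w i ∈ degreeLE e C)
    (hwC' : ∀ i, w' i ∈ degreeLE e C) (hQ : Fintype.card ι * (p ^ μ + 2 + C) < p ^ ν)
    (S : Finset (R →ₐ[k] k)) (hS : ∀ P ∈ S, base P ^ p ^ (μ + ν) = base P)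
    (hS' : ∀ P ∈ S, ∀ i, P (w i) ^ p ^ (μ + ν) = P (w' i)) :
    S.card ≤ p ^ (μ + ν) + Fintype.card ι * (3 * C + 2) * (p ^ ν + p ^ μ + 1) := by
  have : Nonempty ι := e.index_nonempty
  obtain ⟨r, hr⟩ : ∃ r, r = Fintype.card ι := ⟨_, rfl⟩
  obtain ⟨ρ, hρ⟩ : ∃ ρ, ρ = p ^ μ := ⟨_, rfl⟩
  have hr0 : 0 < r := hr ▸ Fintype.card_pos
  have hX : ∀ n a : ℕ, a < n + 1 → (X ^ a : k[X]).natDegree ≤ n := fun n a h => by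
    rw [natDegree_X_pow]
    omega
  obtain ⟨M, hM⟩ : ∃ M, M = ρ / r + C + 1 := ⟨_, rfl⟩
  have hM1 : r * M ≤ ρ + r * (C + 1) := by
    rw [hM, add_assoc, mul_add]
    exact Nat.add_le_add_right (Nat.mul_div_le ρ r) _
  have hM2 : ρ + r * (C + 1) + 1 ≤ r * (M + 1) := by
    have := Nat.lt_mul_div_succ ρ hr0
    rw [hM]
    calc ρ + r * (C + 1) + 1 ≤ r * (ρ / r + 1) + r * (C + 1) := by omega
      _ = _ := by ring
  have key := card_points_le_aux (μ := μ) (ν := ν) (L := ρ + 2) (N := C + M) hC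
    (linearIndependent_X_pow_smul e.linearIndependent (ρ + 2 + 1))
    (linearIndependent_X_pow_smul hw (M + 1))
    (g' := fun x : Fin (M + 1) × ι => (X ^ (x.1 : ℕ) : k[X]) • w' x.2)
    (fun x => by simpa using smul_mem_degreeLE (hX _ _ x.1.2) (basis_mem_degreeLE e x.2))
    (fun x => smul_mem_degreeLE (hX _ _ x.1.2) (hwC x.2))
    (fun x => smul_mem_degreeLE (hX _ _ x.1.2) (hwC' x.2)) (by rw [hρ]; exact hQ) ?_ S
    (fun P hP x => by
      simp only [Algebra.smul_def, map_mul, apply_algebraMap, eval_pow, eval_X, mul_pow]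
      rw [hS' P hP, pow_right_comm, hS P hP])
  · refine key.trans ?_
    rw [← hr, ← hρ, pow_add, ← hρ]
    have h1 : p ^ ν * (r * M) ≤ p ^ ν * (ρ + r * (C + 1)) := Nat.mul_le_mul_left _ hM1
    nlinarith [Nat.zero_le (r * C), Nat.zero_le (r * ρ * C), Nat.zero_le (r * p ^ ν),
      Nat.zero_le (r * ρ)]
  · simp only [Fintype.card_prod, Fintype.card_fin, ← hr, ← hρ]
    have h2 : ρ + C + 2 ≤ r * (M + 1) := by nlinarith [hM2, hr0, Nat.zero_le C]
    have h3 : M ≤ ρ + C + 1 := by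
      rw [hM]
      have := Nat.div_le_self ρ r
      omega
    have h4 : ρ * (ρ + 2 + C) + (C + M) + C + 1 < (ρ + 2 + 1) * (r * (M + 1)) :=
      lt_of_lt_of_le (by nlinarith) (Nat.mul_le_mul_left (ρ + 2 + 1) h2)
    calc r * (ρ * (ρ + 2 + C) + (C + M) + C + 1) < r * ((ρ + 2 + 1) * (r * (M + 1))) :=
          Nat.mul_lt_mul_of_pos_left h4 hr0
      _ = _ := by ring

end Stepanov

theorem exists_finset_pow_eq_self (k : Type*) [Field k] [IsAlgClosed k] (p : ℕ) [Fact p.Prime]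
    [CharP k p] {a : ℕ} (ha : a ≠ 0) :
    ∃ U : Finset k, U.card = p ^ a ∧ ∀ u, u ∈ U ↔ u ^ p ^ a = u := by
  classical
  have hp : 1 < p := (Fact.out : p.Prime).one_lt
  have hne : (X ^ p ^ a - X : k[X]) ≠ 0 := FiniteField.X_pow_card_pow_sub_X_ne_zero k ha hp
  refine ⟨(X ^ p ^ a - X : k[X]).roots.toFinset, ?_, fun u => ?_⟩
  · rw [Multiset.toFinset_card_of_nodup
      (nodup_roots (galois_poly_separable p (p ^ a) (dvd_pow_self p ha))),
      ← (IsAlgClosed.splits _).natDegree_eq_card_roots,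
      FiniteField.X_pow_card_pow_sub_X_natDegree_eq k ha hp]
  · rw [Multiset.mem_toFinset, mem_roots hne]
    simp [sub_eq_zero]

section Equidistribution

variable {k R ι : Type*} [Field k] [CommRing R] [Algebra k[X] R] [Algebra k R]
  [IsScalarTower k k[X] R] [IsDomain R] [Fintype ι] [IsAlgClosed k]
  {p : ℕ} [Fact p.Prime] [CharP k p]

theorem exists_point_frobenius (e : Module.Basis ι k[X] R) {w : ι → R}
    (hw : LinearIndependent k[X] w) [Finite (R ≃ₐ[k[X]] R)] {I : Type*} (x : I → R)
    (hx : ∀ i, w i ∈ Submonoid.closure (Set.range x)) {δ : R} (hδ : δ ≠ 0)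
    (hfree : ∀ P : R →ₐ[k] k, P δ ≠ 0 → Function.Injective (twist P))
    {d : ℕ} (hcover : ∀ (a : ℕ) (P : R →ₐ[k] k), d ∣ a → P δ ≠ 0 → base P ^ p ^ a = base P →
      ∃ σ : R ≃ₐ[k[X]] R, ∀ i, P (x i) ^ p ^ a = P (σ (x i))) (σ : R ≃ₐ[k[X]] R) :
    ∃ N : ℕ, ∀ a ≥ N, d ∣ a → ∃ P : R →ₐ[k] k, P δ ≠ 0 ∧ base P ^ p ^ a = base P ∧
      ∀ i, P (x i) ^ p ^ a = P (σ (x i)) := by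
  classical
  have := Fintype.ofFinite (R ≃ₐ[k[X]] R)
  obtain ⟨C₁, hC₁⟩ := exists_mulBound e
  obtain ⟨C₂, hC₂⟩ := exists_mem_degreeLE e (fun y : ι × (R ≃ₐ[k[X]] R) => y.2 (w y.1))
  obtain ⟨C₃, hC₃⟩ := exists_mem_degreeLE e w
  obtain ⟨C, hC⟩ : ∃ C, C = C₁ + C₂ + C₃ := ⟨_, rfl⟩
  obtain ⟨B, hB⟩ : ∃ B, B = Module.finrank k (R ⧸ Ideal.span {δ}) := ⟨_, rfl⟩
  obtain ⟨r, hr⟩ : ∃ r, r = Fintype.card ι := ⟨_, rfl⟩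
  obtain ⟨g, hg⟩ : ∃ g, g = Fintype.card (R ≃ₐ[k[X]] R) := ⟨_, rfl⟩
  obtain ⟨c, hc⟩ : ∃ c, c = r * (3 + C) + g * B + 3 * g * (r * (3 * C + 2)) + 1 := ⟨_, rfl⟩
  refine ⟨3 * c, fun a ha hda => ?_⟩
  obtain ⟨μ, ν, hμν, hμ, hν⟩ : ∃ μ ν, a = μ + ν ∧ c ≤ μ ∧ 2 * μ ≤ ν :=
    ⟨a / 3, a - a / 3, by omega, by omega, by omega⟩
  have hp : p.Prime := Fact.out
  have hcμ : c < p ^ μ := (hμ.trans_lt μ.lt_two_pow_self).trans_le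
    (Nat.pow_le_pow_left hp.two_le μ)
  have hνμ : p ^ μ * p ^ μ ≤ p ^ ν := by
    rw [← pow_add]
    exact Nat.pow_le_pow_right hp.pos (by omega)
  have hμ0 : 0 < p ^ μ := pow_pos hp.pos μ
  have hQ : r * (p ^ μ + 2 + C) < p ^ ν := by
    have h1 : r * (3 + C) * p ^ μ < p ^ μ * p ^ μ := Nat.mul_lt_mul_of_pos_right (by omega) hμ0
    have h2 : r * (p ^ μ + 2 + C) ≤ r * ((3 + C) * p ^ μ) := Nat.mul_le_mul_left r (by nlinarith)
    calc r * (p ^ μ + 2 + C) ≤ r * (3 + C) * p ^ μ := by rw [mul_assoc]; exact h2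
      _ < _ := h1.trans_le hνμ
  have hbound : ∀ (τ : R ≃ₐ[k[X]] R) (S : Finset (R →ₐ[k] k)),
      (∀ P ∈ S, base P ^ p ^ a = base P ∧ ∀ i, P (x i) ^ p ^ a = P (τ (x i))) →
      S.card ≤ p ^ a + r * (3 * C + 2) * (3 * p ^ ν) := fun τ S hS => by
    refine (card_points_le (w' := fun i => τ (w i)) (hC₁.mono (by omega : C₁ ≤ C)) hw
      (fun i => degreeLE_mono e (by omega) (hC₃ i))
      (fun i => degreeLE_mono e (by omega) (hC₂ (i, τ))) (hr ▸ hQ) S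
      (fun P hP => hμν ▸ (hS P hP).1) fun P hP i => ?_).trans ?_
    · rw [← hμν]
      have hmem := hx i
      generalize w i = y at hmem
      induction hmem using Submonoid.closure_induction with
      | mem y hy => obtain ⟨i, rfl⟩ := hy; exact (hS P hP).2 i
      | one => simp
      | mul y z _ _ hy hz => rw [map_mul, map_mul, map_mul, mul_pow, hy, hz]
    · rw [← hμν, ← hr]
      gcongr
      nlinarith
  obtain ⟨U, hUcard, hU⟩ := exists_finset_pow_eq_self k p (a := a) (by omega)
  choose Pt hPt using exists_point e (k := k) (R := R)
  let good : Finset k := U.filter fun u => ∀ P : R →ₐ[k] k, base P = u → P δ ≠ 0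
  have hgood : p ^ a ≤ good.card + B := by
    rw [← hUcard, ← Finset.card_filter_add_card_filter_not
      (s := U) (fun u => ∀ P : R →ₐ[k] k, base P = u → P δ ≠ 0)]
    refine Nat.add_le_add_left ?_ _
    have hex : ∀ u ∈ U.filter (fun u => ¬ ∀ P : R →ₐ[k] k, base P = u → P δ ≠ 0),
        ∃ P : R →ₐ[k] k, base P = u ∧ P δ = 0 := fun u hu => by
      simpa using (Finset.mem_filter.1 hu).2
    have : Nonempty (R →ₐ[k] k) := ⟨Pt 0⟩
    choose! Z hZ using hex
    rw [hB, ← Finset.card_image_of_injOn (f := Z) fun u hu v hv h => by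
      rw [← (hZ u hu).1, ← (hZ v hv).1, h]]
    refine card_le_finrank_quotient_span e hδ _ fun P hP => ?_
    obtain ⟨u, hu, rfl⟩ := Finset.mem_image.1 hP
    exact (hZ u hu).2
  by_contra! hno
  let T : Finset (R →ₐ[k] k) :=
    (good ×ˢ (Finset.univ : Finset (R ≃ₐ[k[X]] R))).image fun y => twist (Pt y.1) y.2
  have hTgood : ∀ P ∈ T, P δ ≠ 0 ∧ base P ^ p ^ a = base P := fun P hP => by
    obtain ⟨⟨u, τ⟩, hy, rfl⟩ := Finset.mem_image.1 hP
    have hu := Finset.mem_filter.1 (Finset.mem_product.1 hy).1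
    refine ⟨hu.2 _ (by simp [hPt]), ?_⟩
    rw [base_twist, hPt]
    exact (hU u).1 hu.1
  have hTcard : T.card = good.card * g := by
    rw [Finset.card_image_of_injOn, Finset.card_product, Finset.card_univ, hg]
    rintro ⟨u, τ⟩ hy ⟨v, τ'⟩ - h
    have huv : u = v := by simpa [hPt] using congrArg base h
    subst huv
    have hu := Finset.mem_filter.1 (Finset.mem_product.1 hy).1
    exact Prod.ext rfl (hfree (Pt u) (hu.2 _ (hPt u)) h)
  have hTsub : T ⊆ (Finset.univ.erase σ).biUnion fun τ =>
      T.filter fun P => ∀ i, P (x i) ^ p ^ a = P (τ (x i)) := fun P hP => by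
    obtain ⟨h1, h2⟩ := hTgood P hP
    obtain ⟨τ, hτ⟩ := hcover a P hda h1 h2
    refine Finset.mem_biUnion.2 ⟨τ, Finset.mem_erase.2 ⟨?_, Finset.mem_univ _⟩,
      Finset.mem_filter.2 ⟨hP, hτ⟩⟩
    rintro rfl
    obtain ⟨i, hi⟩ := hno P h1 h2
    exact hi (hτ i)
  have hle := (Finset.card_le_card hTsub).trans (Finset.card_biUnion_le_card_mul _ _ _
    fun τ _ => hbound τ _ fun P hP =>
      ⟨(hTgood P (Finset.mem_filter.1 hP).1).2, (Finset.mem_filter.1 hP).2⟩)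
  rw [hTcard, Finset.card_erase_of_mem (Finset.mem_univ _), Finset.card_univ, ← hg] at hle
  obtain ⟨g', rfl⟩ : ∃ g', g = g' + 1 :=
    Nat.exists_eq_succ_of_ne_zero (hg ▸ Fintype.card_ne_zero)
  have hpa : p ^ a = p ^ μ * p ^ ν := by rw [hμν, pow_add]
  have hν0 : 0 < p ^ ν := pow_pos hp.pos ν
  have h5 : c * p ^ ν < p ^ a := hpa ▸ Nat.mul_lt_mul_of_pos_right hcμ hν0
  have h6 : p ^ a ≤ 3 * (g' * (r * (3 * C + 2))) * p ^ ν + (g' + 1) * B := by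
    rw [Nat.add_sub_cancel] at hle
    nlinarith
  have h7 : (g' + 1) * B ≤ (g' + 1) * B * p ^ ν := Nat.le_mul_of_pos_right _ hν0
  have h8 : 3 * (g' * (r * (3 * C + 2))) + (g' + 1) * B ≤ c := by
    rw [hc]
    nlinarith [Nat.zero_le (r * (3 + C)), Nat.zero_le (r * (3 * C + 2))]
  have h9 := Nat.mul_le_mul_right (p ^ ν) h8
  rw [add_mul] at h9
  omega

end Equidistribution

section Ramification

variable {k R ι : Type*} [Field k] [CommRing R] [Algebra k[X] R] [Algebra k R]
  [IsScalarTower k k[X] R] [IsDomain R] [Fintype ι]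

theorem apply_aeval (P : R →ₐ[k] k) (f : k[X][X]) (x : R) :
    P (aeval x f) = (f.map (evalRingHom (base P))).eval (P x) := by
  have h : (P : R →+* k).comp (algebraMap k[X] R) = evalRingHom (base P) :=
    RingHom.ext (apply_algebraMap P)
  rw [aeval_def, eval_map, ← h]
  exact hom_eval₂ f (algebraMap k[X] R) (P : R →+* k) x

theorem exists_idempotent_mod [Fintype (R ≃ₐ[k[X]] R)] [DecidableEq (R ≃ₐ[k[X]] R)]
    {P : R →ₐ[k] k} (h : Function.Injective (twist P)) :
    ∃ ε : R, ∀ σ, twist P σ ε = if σ = 1 then 1 else 0 := by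
  have hsep : ∀ σ : R ≃ₐ[k[X]] R, ∃ z : R, P z = 1 ∧ (σ ≠ 1 → P (σ z) = 0) := fun σ => by
    by_cases hσ : σ = 1
    · exact ⟨1, map_one _, fun h => (h hσ).elim⟩
    obtain ⟨z, hz⟩ := DFunLike.ne_iff.1 (h.ne hσ)
    simp only [twist_apply, AlgEquiv.one_apply] at hz
    have hz' : P z - P (σ z) ≠ 0 := sub_ne_zero.2 (Ne.symm hz)
    have hk : ∀ c : k, σ (algebraMap k R c) = algebraMap k R c := fun c => by
      rw [IsScalarTower.algebraMap_apply k k[X] R, AlgEquiv.commutes]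
    refine ⟨algebraMap k R (P z - P (σ z))⁻¹ * (z - algebraMap k R (P (σ z))), ?_, fun _ => ?_⟩
    · rw [map_mul, map_sub, AlgHom.commutes, AlgHom.commutes]
      exact inv_mul_cancel₀ hz'
    · rw [map_mul, map_sub, hk, hk, map_mul, map_sub, AlgHom.commutes, AlgHom.commutes]
      simp
  choose z hz1 hz0 using hsep
  refine ⟨∏ σ, z σ, fun σ => ?_⟩
  rw [map_prod]
  split_ifs with hσ
  · subst hσ
    exact Finset.prod_eq_one fun τ _ => by simp [hz1]
  · exact Finset.prod_eq_zero (Finset.mem_univ σ) (hz0 σ hσ)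

theorem mem_span_of_forall_twist (e : Module.Basis ι k[X] R) [Fintype (R ≃ₐ[k[X]] R)]
    (hcard : Fintype.card (R ≃ₐ[k[X]] R) = Fintype.card ι)
    {P : R →ₐ[k] k} (h : Function.Injective (twist P)) {z : R} (hz : ∀ σ, twist P σ z = 0) :
    z ∈ Ideal.span {algebraMap k[X] R (X - C (base P))} := by
  classical
  have : Module.Free k[X] R := Module.Free.of_basis e
  set v := algebraMap k[X] R (X - C (base P)) with hv
  have hv0 : v ≠ 0 := by
    rw [hv, Ne, FaithfulSMul.algebraMap_eq_zero_iff]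
    exact X_sub_C_ne_zero _
  have := finite_quotient_span e hv0
  have hPv : ∀ σ : R ≃ₐ[k[X]] R, ∀ y ∈ Ideal.span {v}, twist P σ y = 0 := fun σ y hy => by
    obtain ⟨y, rfl⟩ := Ideal.mem_span_singleton'.1 hy
    rw [map_mul, hv, apply_algebraMap]
    simp
  let ev : (R ⧸ Ideal.span {v}) →ₗ[k] ((R ≃ₐ[k[X]] R) → k) :=
    LinearMap.pi fun σ => (Ideal.Quotient.liftₐ _ (twist P σ) (hPv σ)).toLinearMap
  have hev : ∀ y σ, ev (Ideal.Quotient.mk _ y) σ = twist P σ y := fun y σ => rfl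
  have hsurj : Function.Surjective ev := fun c => by
    obtain ⟨ε, hε⟩ := exists_idempotent_mod h
    refine ⟨Ideal.Quotient.mk _ (∑ τ : R ≃ₐ[k[X]] R, c τ • τ⁻¹ ε), funext fun σ => ?_⟩
    rw [hev, map_sum, Finset.sum_eq_single σ]
    · rw [map_smul, smul_eq_mul]
      have := hε 1
      simp only [twist_apply, AlgEquiv.one_apply, if_true] at this
      rw [twist_apply, ← AlgEquiv.mul_apply, mul_inv_cancel, AlgEquiv.one_apply, this, mul_one]
    · intro τ _ hτ
      have := hε (σ * τ⁻¹)
      rw [if_neg (by rwa [mul_inv_eq_one, eq_comm])] at this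
      rw [map_smul, smul_eq_mul]
      simpa [twist_apply] using Or.inr this
    · simp
  have hinj : Function.Injective ev := by
    refine (LinearMap.injective_iff_surjective_of_finrank_eq_finrank ?_).2 hsurj
    rw [finrank_quotient_span_algebraMap e, Module.finrank_fintype_fun_eq_card, hcard]
  rw [← Ideal.Quotient.eq_zero_iff_mem]
  exact hinj (funext fun σ => by rw [hev, hz σ, map_zero]; rfl)

/-- A point of the cover at which a root `x` of `f` is simply ramified has a nontrivial inertia
automorphism. -/
theorem exists_twist_eq_self (e : Module.Basis ι k[X] R) [Fintype (R ≃ₐ[k[X]] R)]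
    (hcard : Fintype.card (R ≃ₐ[k[X]] R) = Fintype.card ι) {f : k[X][X]} {x : R}
    (hx : aeval x f = 0) (P : R →ₐ[k] k)
    (ht : (f.derivative.eval (C (P x))).eval (base P) = 0)
    (hu : (f.eval (C (P x))).derivative.eval (base P) ≠ 0) :
    ∃ σ : R ≃ₐ[k[X]] R, σ ≠ 1 ∧ twist P σ = P := by
  classical
  by_contra! hno
  have hinj : Function.Injective (twist P) := fun σ τ h => by
    by_contra hne
    refine hno (σ * τ⁻¹) (by rwa [Ne, mul_inv_eq_one]) (AlgHom.ext fun y => ?_)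
    have := DFunLike.congr_fun h (τ⁻¹ y)
    simpa [twist_apply] using this
  set v := algebraMap k[X] R (X - C (base P)) with hv
  have hvm : v ∈ RingHom.ker P := by
    rw [RingHom.mem_ker, hv, apply_algebraMap]
    simp
  -- the maximal ideal is generated by `v` modulo its square
  have hle : RingHom.ker P ≤ RingHom.ker P ^ 2 ⊔ Ideal.span {v} := fun z hz => by
    obtain ⟨ε, hε⟩ := exists_idempotent_mod hinj
    rw [show z = z * (1 - ε) + z * ε by ring]
    refine Submodule.add_mem_sup ?_ (mem_span_of_forall_twist e hcard hinj fun σ => ?_)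
    · rw [pow_two]
      refine Ideal.mul_mem_mul hz ?_
      have := hε 1
      simp only [twist_apply, AlgEquiv.one_apply, if_true] at this
      rw [RingHom.mem_ker, map_sub, map_one, this, sub_self]
    · rw [map_mul, hε]
      split_ifs with h
      · subst h
        simpa using hz
      · simp
  let q := Ideal.Quotient.mk (RingHom.ker P ^ 2)
  have hq2 : ∀ a ∈ RingHom.ker P, ∀ b ∈ RingHom.ker P, q a * q b = 0 := fun a ha b hb => by
    rw [← map_mul, Ideal.Quotient.eq_zero_iff_mem, pow_two]
    exact Ideal.mul_mem_mul ha hb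
  have hcoef : ∀ p : k[X], q (algebraMap k[X] R p) =
      q (algebraMap k R (p.eval (base P))) + q (algebraMap k R (p.derivative.eval (base P))) *
        q v :=
    fun p => by
      have h1 : algebraMap k[X] R p = aeval (algebraMap k R (base P) + v) p := by
        have : algebraMap k R (base P) + v = algebraMap k[X] R X := by
          rw [hv, map_sub, IsScalarTower.algebraMap_apply k k[X] R]
          simp
        rw [this, aeval_algebraMap_apply, aeval_X_left_apply]
      have h2 : q (aeval (algebraMap k R (base P) + v) p) =
          aeval (q (algebraMap k R (base P)) + q v) p := by
        rw [← map_add]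
        exact (aeval_algebraMap_apply (R ⧸ RingHom.ker P ^ 2) _ p).symm
      rw [h1, h2, aeval_add_of_sq_eq_zero _ _ _ ((pow_two _).trans (hq2 v hvm v hvm))]
      have h3 : ∀ p : k[X], aeval (q (algebraMap k R (base P))) p =
          q (algebraMap k R (p.eval (base P))) := fun p => by
        have := aeval_algebraMap_apply (R ⧸ RingHom.ker P ^ 2) (base P) p
        rwa [coe_aeval_eq_eval] at this
      rw [h3, h3]
  set y := x - algebraMap k R (P x) with hy
  have hym : y ∈ RingHom.ker P := by
    rw [RingHom.mem_ker, hy, map_sub, AlgHom.commutes]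
    simp
  have hexp : q (aeval x f) = q (algebraMap k[X] R (f.eval (C (P x)))) +
      q (algebraMap k[X] R (f.derivative.eval (C (P x)))) * q y := by
    have h1 : q (aeval x f) = aeval (q (algebraMap k R (P x)) + q y) f := by
      rw [← map_add, hy, add_sub_cancel]
      exact (aeval_algebraMap_apply (R ⧸ RingHom.ker P ^ 2) x f).symm
    have h3 : ∀ f : k[X][X], aeval (q (algebraMap k R (P x))) f =
        q (algebraMap k[X] R (f.eval (C (P x)))) := fun f => by
      have := aeval_algebraMap_apply (R ⧸ RingHom.ker P ^ 2) (C (P x)) f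
      rw [coe_aeval_eq_eval] at this
      rw [IsScalarTower.algebraMap_apply k k[X] R]
      exact this
    rw [h1, aeval_add_of_sq_eq_zero _ _ _ ((pow_two _).trans (hq2 y hym y hym)), h3, h3]
  have hf0 : (f.eval (C (P x))).eval (base P) = 0 := by
    rw [← evalEval, ← map_evalRingHom_eval, ← apply_aeval, hx, map_zero]
  have hqv : q v = 0 := by
    rw [hx, map_zero, hcoef (f.eval (C (P x))), hcoef (f.derivative.eval (C (P x))), ht, hf0,
      add_mul, mul_assoc, hq2 v hvm y hym] at hexp
    simp only [map_zero, zero_add, zero_mul, mul_zero, add_zero] at hexp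
    have hunit : IsUnit (q (algebraMap k R ((f.eval (C (P x))).derivative.eval (base P)))) :=
      ((isUnit_iff_ne_zero.2 hu).map (algebraMap k R)).map q
    exact (hunit.mul_right_eq_zero).1 hexp.symm
  have hv2 : v ∈ RingHom.ker P ^ 2 := Ideal.Quotient.eq_zero_iff_mem.1 hqv
  have hle2 : RingHom.ker P ≤ RingHom.ker P ^ 2 :=
    hle.trans (sup_le le_rfl ((Ideal.span_singleton_le_iff_mem _).2 hv2))
  have := ker_pow_succ_lt e P 1
  rw [pow_one] at this
  exact absurd (hle2.trans_lt this) (lt_irrefl _)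

end Ramification

section Inertia

variable {k R ι : Type*} [Field k] [CommRing R] [Algebra k[X] R] [Algebra k R]
  [IsScalarTower k k[X] R] [IsDomain R] {I J : Type*} [Fintype I] [Fintype J]

theorem exists_perm_of_map_eq_prod {f : k[X][X]} {x : I → R} (hx : Function.Injective x)
    (hf : f.map (algebraMap k[X] R) = ∏ i, (X - C (x i))) (σ : R ≃ₐ[k[X]] R) :
    ∃ π : Equiv.Perm I, ∀ i, σ (x i) = x (π i) := by
  have hroot : ∀ i, ∃ j, σ (x i) = x j := fun i => by
    have h1 : aeval (x i) f = 0 := by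
      rw [← eval_map_algebraMap, hf, eval_prod]
      exact Finset.prod_eq_zero (Finset.mem_univ i) (by simp)
    have h2 : aeval (σ (x i)) f = 0 := by
      rw [← AlgEquiv.coe_toAlgHom, aeval_algHom_apply, h1, map_zero]
    rw [← eval_map_algebraMap, hf, eval_prod, Finset.prod_eq_zero_iff] at h2
    obtain ⟨j, -, hj⟩ := h2
    exact ⟨j, by simpa [sub_eq_zero] using hj⟩
  choose π hπ using hroot
  have hinj : Function.Injective π := fun i j h => hx (σ.injective (by rw [hπ, hπ, h]))
  exact ⟨Equiv.ofBijective π (Finite.injective_iff_bijective.1 hinj), hπ⟩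

theorem map_evalRingHom_eq_prod {f : k[X][X]} {x : I → R}
    (hf : f.map (algebraMap k[X] R) = ∏ i, (X - C (x i))) (P : R →ₐ[k] k) :
    f.map (evalRingHom (base P)) = ∏ i, (X - C (P (x i))) := by
  have h : (P : R →+* k).comp (algebraMap k[X] R) = evalRingHom (base P) :=
    RingHom.ext (apply_algebraMap P)
  rw [← h, ← Polynomial.map_map, hf, Polynomial.map_prod]
  simp

theorem isSwap_of_prod_eq [DecidableEq I] {x : I → k} {π : Equiv.Perm I} (hπ : π ≠ 1)
    (hx : ∀ i, x (π i) = x i)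
    {a : k} {B : k[X]} (hprod : ∏ i, (X - C (x i)) = (X - C a) ^ 2 * B) (hB : B.Separable)
    (ha : B.eval a ≠ 0) : π.IsSwap := by
  have := Classical.decEq k
  have h1 : ∀ i j, i ≠ j → x i = x j → x i = a := fun i j hij h => by
    by_contra hne
    have hdvd : (X - C (x i)) ^ 2 ∣ (X - C a) ^ 2 * B := by
      rw [← hprod, ← Finset.mul_prod_erase _ _ (Finset.mem_univ i), ← Finset.mul_prod_erase _ _
        (Finset.mem_erase.2 ⟨hij.symm, Finset.mem_univ j⟩), h, ← mul_assoc, sq]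
      exact dvd_mul_right _ _
    have hcop : IsCoprime ((X - C (x i)) ^ 2) ((X - C a) ^ 2) :=
      (isCoprime_X_sub_C_of_isUnit_sub (sub_ne_zero.2 hne).isUnit).pow
    have := hB.squarefree (X - C (x i)) (by rw [← sq]; exact hcop.dvd_of_dvd_mul_left hdvd)
    exact not_isUnit_X_sub_C _ this
  have h2 : (Finset.univ.filter fun i => x i = a).card ≤ 2 := by
    by_contra! hlt
    have hdvd : (X - C a) ^ 3 ∣ (X - C a) ^ 2 * B := by
      refine (pow_dvd_pow _ hlt).trans ?_
      rw [← hprod, ← Finset.prod_const]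
      rw [Finset.prod_congr rfl fun i hi => by rw [← (Finset.mem_filter.1 hi).2]]
      exact Finset.prod_dvd_prod_of_subset _ _ _ (Finset.filter_subset _ _)
    rw [pow_succ, mul_dvd_mul_iff_left (pow_ne_zero 2 (X_sub_C_ne_zero a)), dvd_iff_isRoot] at hdvd
    exact ha hdvd
  have hsub : π.support ⊆ Finset.univ.filter fun i => x i = a := fun i hi => by
    rw [Finset.mem_filter]
    exact ⟨Finset.mem_univ i, h1 i (π i) (Equiv.Perm.mem_support.1 hi).symm (hx i).symm⟩
  rw [← Equiv.Perm.card_support_eq_two]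
  exact le_antisymm ((Finset.card_le_card hsub).trans h2)
    (Equiv.Perm.two_le_card_support_of_ne_one hπ)

/-- Simple ramification over a point of the line produces a transposition. -/
theorem exists_algEquiv_isSwap [Fintype ι] [DecidableEq I] [IsAlgClosed k]
    (e : Module.Basis ι k[X] R)
    [Fintype (R ≃ₐ[k[X]] R)] (hcard : Fintype.card (R ≃ₐ[k[X]] R) = Fintype.card ι)
    {f g : k[X][X]} {x : I → R} {y : J → R} (hx : Function.Injective x) (hy : Function.Injective y)
    (hf : f.map (algebraMap k[X] R) = ∏ i, (X - C (x i)))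
    (hg : g.map (algebraMap k[X] R) = ∏ j, (X - C (y j)))
    (hgen : ∀ σ : R ≃ₐ[k[X]] R, (∀ i, σ (x i) = x i) → (∀ j, σ (y j) = y j) → σ = 1)
    {u a : k} {B : k[X]} (hfu : f.map (evalRingHom u) = (X - C a) ^ 2 * B) (hB : B.Separable)
    (ha : B.eval a ≠ 0) (hu : (f.eval (C a)).derivative.eval u ≠ 0)
    (hgu : (g.map (evalRingHom u)).Separable) :
    ∃ (σ : R ≃ₐ[k[X]] R) (π : Equiv.Perm I), π.IsSwap ∧ (∀ i, σ (x i) = x (π i)) ∧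
      ∀ j, σ (y j) = y j := by
  obtain ⟨P, rfl⟩ := exists_point e u
  have hfP := map_evalRingHom_eq_prod hf P
  have hgP := map_evalRingHom_eq_prod hg P
  obtain ⟨i, hi⟩ : ∃ i, P (x i) = a := by
    have h : (∏ i, (X - C (P (x i)))).eval a = 0 := by rw [← hfP, hfu]; simp
    rw [eval_prod, Finset.prod_eq_zero_iff] at h
    obtain ⟨i, -, hi⟩ := h
    rw [eval_sub, eval_X, eval_C, sub_eq_zero] at hi
    exact ⟨i, hi.symm⟩
  subst hi
  have hroot : aeval (x i) f = 0 := by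
    rw [← eval_map_algebraMap, hf, eval_prod]
    exact Finset.prod_eq_zero (Finset.mem_univ i) (by simp)
  obtain ⟨σ, hσ1, hσ⟩ := exists_twist_eq_self e hcard hroot P (by
    rw [← evalEval, ← map_evalRingHom_eval, ← derivative_map, hfu]
    simp [derivative_mul, derivative_pow]) hu
  obtain ⟨π, hπ⟩ := exists_perm_of_map_eq_prod hx hf σ
  obtain ⟨π', hπ'⟩ := exists_perm_of_map_eq_prod hy hg σ
  have hfix : ∀ z, P (σ z) = P z := fun z => DFunLike.congr_fun hσ z
  have hyσ : ∀ j, σ (y j) = y j := fun j => by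
    rw [hgP, separable_prod_X_sub_C_iff] at hgu
    rw [hπ', @hgu (π' j) j (by simp only [← hπ', hfix])]
  refine ⟨σ, π, isSwap_of_prod_eq (x := fun i => P (x i)) ?_ (fun i => ?_) (hfP ▸ hfu) hB ha, hπ,
    hyσ⟩
  · rintro rfl
    exact hσ1 (hgen σ hπ hyσ)
  · rw [← hπ, hfix]

end Inertia

section PermutationGroups

variable {I J : Type*} [Fintype I] [Fintype J] [DecidableEq I] [DecidableEq J]

theorem subgroup_perm_eq_top {M H : Subgroup (Equiv.Perm I)}
    (hconj : ∀ h ∈ H, ∀ s ∈ M, h * s * h⁻¹ ∈ M) (htrans : ∀ i j, ∃ h ∈ H, h i = j) {ξ : I}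
    (hstab : ∀ i j, i ≠ ξ → j ≠ ξ → ∃ h ∈ H, h ξ = ξ ∧ h i = j) {π : Equiv.Perm I} (hπM : π ∈ M)
    (hπ : π.IsSwap) : M = ⊤ := by
  obtain ⟨a, b, hab, rfl⟩ := hπ
  have hξ : ∀ c, c ≠ ξ → Equiv.swap ξ c ∈ M := fun c hc => by
    obtain ⟨h, hH, ha⟩ := htrans a ξ
    obtain ⟨h', hH', hξ', hb⟩ := hstab (h b) c (fun hb => hab (h.injective (ha.trans hb.symm))) hc
    have h1 := hconj h' hH' _ (hconj h hH _ hπM)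
    rwa [← Equiv.swap_apply_apply, ← Equiv.swap_apply_apply, ha, hξ', hb] at h1
  rw [eq_top_iff, ← Equiv.Perm.closure_isSwap, Subgroup.closure_le]
  rintro _ ⟨i, j, hij, rfl⟩
  rcases eq_or_ne i ξ with rfl | hi
  · exact hξ j hij.symm
  rcases eq_or_ne j ξ with rfl | hj
  · rw [Equiv.swap_comm]
    exact hξ i hi
  have h1 := M.mul_mem (M.mul_mem (hξ i hi) (hξ j hj)) (M.inv_mem (hξ i hi))
  rwa [← Equiv.swap_apply_apply, Equiv.swap_apply_left, Equiv.swap_apply_of_ne_of_ne hj hij.symm]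
    at h1

theorem exists_isSwap_of_card_eq_three (hI : Fintype.card I = 3) {H : Subgroup (Equiv.Perm I)}
    {ξ : I} (hstab : ∀ i j, i ≠ ξ → j ≠ ξ → ∃ h ∈ H, h ξ = ξ ∧ h i = j) :
    ∃ π ∈ H, π.IsSwap := by
  have hcard : (Finset.univ.erase ξ).card = 2 := by
    rw [Finset.card_erase_of_mem (Finset.mem_univ ξ), Finset.card_univ, hI]
  obtain ⟨a, b, hab, heq⟩ := Finset.card_eq_two.1 hcard
  have ha : a ≠ ξ := Finset.ne_of_mem_erase (heq ▸ Finset.mem_insert_self a {b})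
  have hb : b ≠ ξ := Finset.ne_of_mem_erase
    (heq ▸ Finset.mem_insert_of_mem (Finset.mem_singleton_self b))
  obtain ⟨π, hπ, hξ, hπa⟩ := hstab a b ha hb
  refine ⟨π, hπ, Equiv.Perm.card_support_eq_two.1 (le_antisymm ?_
    (Equiv.Perm.two_le_card_support_of_ne_one ?_))⟩
  · rw [← hcard]
    refine Finset.card_le_card fun i hi => Finset.mem_erase.2 ⟨?_, Finset.mem_univ i⟩
    rintro rfl
    exact Equiv.Perm.mem_support.1 hi hξ
  · rintro rfl
    exact hab hπa

theorem subgroup_prod_perm_eq_top {N : Subgroup (Equiv.Perm I × Equiv.Perm J)}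
    (htransI : ∀ i j, ∃ h ∈ N, h.1 i = j) {ξ : I}
    (hstabI : ∀ i j, i ≠ ξ → j ≠ ξ → ∃ h ∈ N, h.1 ξ = ξ ∧ h.1 i = j)
    (htransJ : ∀ i j, ∃ h ∈ N, h.2 i = j) {η : J}
    (hstabJ : ∀ i j, i ≠ η → j ≠ η → ∃ h ∈ N, h.2 η = η ∧ h.2 i = j)
    (hswapI : ∃ π : Equiv.Perm I, π.IsSwap ∧ (π, 1) ∈ N)
    (hswapJ : Fintype.card J = 3 ∨ ∃ h ∈ N, h.2.IsSwap) : N = ⊤ := by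
  obtain ⟨π, hπ, hπN⟩ := hswapI
  have h1 : N.comap (MonoidHom.inl _ _) = ⊤ := by
    refine subgroup_perm_eq_top (H := N.map (MonoidHom.fst _ _)) (ξ := ξ) ?_ ?_ ?_
      (Subgroup.mem_comap.2 hπN) hπ
    · rintro _ ⟨h, hh, rfl⟩ s hs
      have := N.mul_mem (N.mul_mem hh hs) (N.inv_mem hh)
      rw [Subgroup.mem_comap]
      convert this using 1
      ext <;> simp
    · intro i j
      obtain ⟨h, hh, hij⟩ := htransI i j
      exact ⟨h.1, ⟨h, hh, rfl⟩, hij⟩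
    · intro i j hi hj
      obtain ⟨h, hh, hij⟩ := hstabI i j hi hj
      exact ⟨h.1, ⟨h, hh, rfl⟩, hij⟩
  have hstab : ∀ i j, i ≠ η → j ≠ η → ∃ h ∈ N.map (MonoidHom.snd _ _), h η = η ∧ h i = j := by
    intro i j hi hj
    obtain ⟨h, hh, hij⟩ := hstabJ i j hi hj
    exact ⟨h.2, ⟨h, hh, rfl⟩, hij⟩
  obtain ⟨s, hsN, hs⟩ : ∃ s ∈ N.map (MonoidHom.snd _ _), s.IsSwap := by
    rcases hswapJ with hJ | ⟨h, hh, hs⟩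
    · exact exists_isSwap_of_card_eq_three hJ hstab
    · exact ⟨h.2, ⟨h, hh, rfl⟩, hs⟩
  have h2 : N.map (MonoidHom.snd _ _) = ⊤ := by
    refine subgroup_perm_eq_top (fun h hh s hs => mul_mem (mul_mem hh hs) (inv_mem hh)) ?_ hstab
      hsN hs
    intro i j
    obtain ⟨h, hh, hij⟩ := htransJ i j
    exact ⟨h.2, ⟨h, hh, rfl⟩, hij⟩
  refine (Subgroup.eq_top_iff' _).2 fun ⟨ρ, τ⟩ => ?_
  obtain ⟨h, hh, hτ⟩ := h2.ge (Subgroup.mem_top τ)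
  have h3 : ρ * h.1⁻¹ ∈ N.comap (MonoidHom.inl _ _) := h1.ge (Subgroup.mem_top _)
  have := N.mul_mem (Subgroup.mem_comap.1 h3) hh
  convert this using 1
  ext <;> simp [← hτ]

end PermutationGroups

section Infinity

variable {k : Type*} [Field k]

/-- A Newton polygon with a first segment of width one and a second segment of slope prime to its
width: the polynomial is a linear factor times an irreducible one. -/
theorem exists_eq_X_sub_C_mul_irreducible {l : ℕ} (hl : l ≠ 0) {f : (PowerSeries k)[X]}
    (hf : f.Monic) (hdeg : f.natDegree = l + 1)
      (h0 : (PowerSeries.X : PowerSeries k) ^ 3 ∣ f.coeff 0)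
    (h1 : ∃ ψ : PowerSeries k, PowerSeries.constantCoeff ψ ≠ 0 ∧ f.coeff 1 = PowerSeries.X * ψ)
    (hcoeff : ∀ i ≤ l, PowerSeries.constantCoeff (f.coeff i) = 0)
    (L : Type*) [Field L] [Algebra (PowerSeries k) L] [IsFractionRing (PowerSeries k) L] :
    ∃ (s : PowerSeries k) (h : (PowerSeries k)[X]), f = (X - C s) * h ∧
      Irreducible (h.map (algebraMap (PowerSeries k) L)) := by
  obtain ⟨φ, hφ⟩ := h0
  obtain ⟨ψ, hψ0, hψ⟩ := h1
  set b := PowerSeries.constantCoeff ψ with hb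
  let q : ℕ → PowerSeries k := fun i =>
    if i = 0 then ψ else f.coeff (i + 1) * PowerSeries.X ^ (2 * i - 1) * φ ^ i
  have hq : ∀ i, f.coeff (i + 1) * (PowerSeries.X ^ 2 * φ) ^ (i + 1) =
      PowerSeries.X ^ 3 * φ * q i := fun i => by
    rcases Nat.eq_zero_or_pos i with rfl | hi
    · simp only [q, if_true, hψ]
      ring
    · obtain ⟨j, rfl⟩ : ∃ j, i = j + 1 := ⟨i - 1, by omega⟩
      simp only [q, Nat.succ_ne_zero, if_false]
      rw [show 2 * (j + 1) - 1 = 2 * j + 1 by omega]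
      ring
  let Q : (PowerSeries k)[X] := X ^ (l + 1) + ∑ i ∈ Finset.range (l + 1), C (q i) * X ^ (l - i)
  have hQ : Q.Monic := by
    refine monic_X_pow_add ?_
    refine (degree_sum_le _ _).trans_lt ((Finset.sup_lt_iff (WithBot.bot_lt_coe _)).2 fun i _ => ?_)
    refine (degree_C_mul_X_pow_le _ _).trans_lt ?_
    exact_mod_cast Nat.lt_succ_of_le (Nat.sub_le l i)
  have hQmap : Q.map PowerSeries.constantCoeff = X ^ l * (X + C b) := by
    have : ∀ i ∈ Finset.range (l + 1), i ≠ 0 →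
        (C (q i) * X ^ (l - i)).map (PowerSeries.constantCoeff : PowerSeries k →+* k) = 0 :=
      fun i _ hi => by
        simp [q, hi, show 2 * i - 1 ≠ 0 by omega]
    rw [Polynomial.map_add, Polynomial.map_sum, Finset.sum_eq_single_of_mem 0 (by simp) this]
    simp [q, ← hb]
    ring
  have hcc : ∀ (p : (PowerSeries k)[X]) (z : PowerSeries k), PowerSeries.constantCoeff (p.eval z) =
      (p.map PowerSeries.constantCoeff).eval (PowerSeries.constantCoeff z) := fun p z => by
    rw [eval_map, eval₂_at_apply]
  obtain ⟨y, hy, hyb⟩ := HenselianRing.is_henselian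
    (I := Ideal.span {(PowerSeries.X : PowerSeries k)})
    Q hQ (PowerSeries.C (-b)) (by
      rw [Ideal.mem_span_singleton, PowerSeries.X_dvd_iff, hcc, hQmap]
      simp) (by
      refine IsUnit.map _ (PowerSeries.isUnit_iff_constantCoeff.2 (isUnit_iff_ne_zero.2 ?_))
      rw [hcc, ← derivative_map, hQmap]
      simp [derivative_mul, hψ0])
  have hy0 : PowerSeries.constantCoeff y ≠ 0 := by
    rw [Ideal.mem_span_singleton, PowerSeries.X_dvd_iff, map_sub, sub_eq_zero] at hyb
    simpa [hyb] using hψ0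
  set s := PowerSeries.X ^ 2 * φ * y⁻¹ with hs
  have hsy : s * y = PowerSeries.X ^ 2 * φ := by
    rw [hs, mul_assoc, PowerSeries.inv_mul_cancel y hy0, mul_one]
  have hyne : y ≠ 0 := by
    rintro rfl
    simp at hy0
  have hroot : f.IsRoot s := by
    have key : f.eval s * y ^ (l + 1) = PowerSeries.X ^ 3 * φ * Q.eval y := by
      rw [eval_eq_sum_range, hdeg, Finset.sum_range_succ', add_mul, Finset.sum_mul, hφ]
      simp only [Q, eval_add, eval_finsetSum, eval_mul, eval_C, eval_pow, eval_X, mul_add,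
        Finset.mul_sum]
      rw [add_comm, pow_zero, mul_one]
      congr 1
      refine Finset.sum_congr rfl fun i hi => ?_
      rw [Finset.mem_range] at hi
      rw [← mul_assoc, ← hq, ← hsy, show l + 1 = i + 1 + (l - i) by omega, pow_add y]
      ring
    rw [hy.eq_zero, mul_zero] at key
    exact (mul_eq_zero.1 key).resolve_right (pow_ne_zero _ hyne)
  obtain ⟨h, rfl⟩ := dvd_iff_isRoot.2 hroot
  have hmon : h.Monic := (monic_X_sub_C s).of_mul_monic_left hf
  have hdegh : h.natDegree = l := by
    rw [(monic_X_sub_C s).natDegree_mul hmon, natDegree_X_sub_C] at hdeg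
    omega
  have hs0 : PowerSeries.constantCoeff s = 0 := by simp [hs]
  have hcoeffh : ∀ i < l, PowerSeries.constantCoeff (h.coeff i) = 0 := fun i hi => by
    have hc := hcoeff (i + 1) hi
    rw [sub_mul, coeff_sub, coeff_X_mul, coeff_C_mul, map_sub, map_mul, hs0, zero_mul, sub_zero]
      at hc
    exact hc
  refine ⟨s, h, rfl, (hmon.irreducible_iff_irreducible_map_fraction_map).1 ?_⟩
  have hP : Ideal.span {(PowerSeries.X : PowerSeries k)} ≠ ⊤ := by
    rw [Ne, Ideal.span_singleton_eq_top]
    exact PowerSeries.X_prime.not_isUnit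
  refine irreducible_of_eisenstein_criterion (P := Ideal.span {PowerSeries.X})
    PowerSeries.span_X_isPrime ?_ (fun i hi => ?_) ?_ ?_ hmon.isPrimitive
  · rw [hmon.leadingCoeff]
    exact (Ideal.ne_top_iff_one _).1 hP
  · rw [Ideal.mem_span_singleton, PowerSeries.X_dvd_iff]
    rw [degree_eq_natDegree hmon.ne_zero, hdegh] at hi
    exact hcoeffh i (by exact_mod_cast hi)
  · rw [← natDegree_pos_iff_degree_pos, hdegh]
    exact Nat.pos_of_ne_zero hl
  · rw [Ideal.span_singleton_pow, Ideal.mem_span_singleton]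
    intro hdvd
    have h2 : (PowerSeries.X : PowerSeries k) ^ 2 ∣ PowerSeries.X * ψ := by
      rw [← hψ, sub_mul, coeff_sub, coeff_X_mul, coeff_C_mul, hs, mul_assoc, mul_assoc]
      exact dvd_sub hdvd (dvd_mul_right _ _)
    rw [sq, mul_dvd_mul_iff_left PowerSeries.X_ne_zero, PowerSeries.X_dvd_iff] at h2
    exact hψ0 h2

end Infinity

section TwoTransitive

/-- If a polynomial becomes, over a bigger field, a linear factor times an irreducible one, then
the stabiliser of one of its roots acts transitively on the other roots. -/
theorem exists_stabilizer_transitive {K E L I : Type*} [Field K] [Field E] [Field L] [Algebra K E]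
    [Normal K E] [Algebra K L] [Fintype I] {f : K[X]} {x : I → E} (hx : Function.Injective x)
    (hf : f.map (algebraMap K E) = ∏ i, (X - C (x i))) {c s : L} (hc : c ≠ 0) {h : L[X]}
    (hh : Irreducible h) (hfac : (f.map (algebraMap K L)).scaleRoots c = (X - C s) * h) :
    ∃ ξ, ∀ i j, i ≠ ξ → j ≠ ξ → ∃ σ : E ≃ₐ[K] E, σ (x ξ) = x ξ ∧ σ (x i) = x j := by
  let Ω := AlgebraicClosure L
  let φ : E →ₐ[K] Ω := IsAlgClosed.lift
  let _ : Algebra E Ω := φ.toRingHom.toAlgebra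
  have : IsScalarTower K E Ω := IsScalarTower.of_algebraMap_eq fun z => (φ.commutes z).symm
  have hφ : ∀ z, algebraMap E Ω z = φ z := fun z => rfl
  have hc' : algebraMap L Ω c ≠ 0 := by simpa using hc
  have hev : ∀ r : Ω, (algebraMap L Ω c * r - algebraMap L Ω s) *
      aeval (algebraMap L Ω c * r) h = algebraMap L Ω c ^ f.natDegree * ∏ i, (r - φ (x i)) := by
    intro r
    have h1 := scaleRoots_eval₂_mul (p := f.map (algebraMap K L)) (algebraMap L Ω) r c
    rw [hfac, natDegree_map, eval₂_map, ← IsScalarTower.algebraMap_eq,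
      IsScalarTower.algebraMap_eq K E Ω, ← eval₂_map, hf] at h1
    simp only [eval₂_mul, eval₂_sub, eval₂_X, eval₂_C, eval₂_finsetProd, hφ] at h1
    exact h1
  obtain ⟨ξ, hξ⟩ : ∃ ξ, algebraMap L Ω c * φ (x ξ) = algebraMap L Ω s := by
    have h1 := hev ((algebraMap L Ω c)⁻¹ * algebraMap L Ω s)
    rw [mul_inv_cancel_left₀ hc', sub_self, zero_mul, eq_comm, mul_eq_zero, or_iff_right
      (pow_ne_zero _ hc'), Finset.prod_eq_zero_iff] at h1
    obtain ⟨ξ, -, h1⟩ := h1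
    refine ⟨ξ, ?_⟩
    rw [← sub_eq_zero.1 h1, mul_inv_cancel_left₀ hc']
  have hroot : ∀ i, i ≠ ξ → aeval (algebraMap L Ω c * φ (x i)) h = 0 := fun i hi => by
    have h1 := hev (φ (x i))
    rw [Finset.prod_eq_zero (Finset.mem_univ i) (sub_self _), mul_zero, mul_eq_zero, ← hξ,
      ← mul_sub,
      mul_eq_zero] at h1
    refine h1.resolve_left (not_or.2 ⟨hc', ?_⟩)
    rw [sub_eq_zero]
    exact fun h2 => hi (hx (φ.injective h2))
  have hφeq : ∀ (θ : Ω ≃ₐ[L] Ω) i j, θ (algebraMap L Ω c * φ (x i)) = algebraMap L Ω c * φ (x j) →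
      (θ.restrictScalars K).restrictNormal E (x i) = x j := fun θ i j hij => by
    rw [map_mul, AlgEquiv.commutes] at hij
    refine (algebraMap E Ω).injective ?_
    rw [AlgEquiv.restrictNormal_commutes]
    exact mul_left_cancel₀ hc' hij
  refine ⟨ξ, fun i j hi hj => ?_⟩
  have hconj : IsConjRoot L (algebraMap L Ω c * φ (x i)) (algebraMap L Ω c * φ (x j)) := by
    rw [isConjRoot_def, ← minpoly.eq_of_irreducible hh (hroot i hi),
      ← minpoly.eq_of_irreducible hh (hroot j hj)]
  obtain ⟨θ, hθ⟩ := isConjRoot_iff_exists_algEquiv.1 hconj.symm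
  refine ⟨(θ.restrictScalars K).restrictNormal E, hφeq θ ξ ξ ?_, hφeq θ i j hθ⟩
  rw [hξ, AlgEquiv.commutes]

variable {k : Type*} [Field k]

/-- The embedding of `k[X]` into the Laurent series at infinity. -/
noncomputable def inftyHom (k L : Type*) [Field k] [Field L] [Algebra (PowerSeries k) L] :
    k[X] →+* L :=
  eval₂RingHom ((algebraMap (PowerSeries k) L).comp PowerSeries.C)
    (algebraMap (PowerSeries k) L PowerSeries.X)⁻¹

section InftyHom

variable (L : Type*) [Field L] [Algebra (PowerSeries k) L] [IsFractionRing (PowerSeries k) L]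

theorem inftyHom_mul_pow {N : ℕ} {p : k[X]} (hp : p.natDegree ≤ N) :
    inftyHom k L p * algebraMap (PowerSeries k) L PowerSeries.X ^ N =
      algebraMap (PowerSeries k) L (reflect N p : k[X]) := by
  set t := algebraMap (PowerSeries k) L PowerSeries.X with ht
  have ht0 : t ≠ 0 := by
    rw [ht, Ne, FaithfulSMul.algebraMap_eq_zero_iff]
    exact PowerSeries.X_ne_zero
  let _ : Invertible t⁻¹ := ⟨t, mul_inv_cancel₀ ht0, inv_mul_cancel₀ ht0⟩
  rw [inftyHom, coe_eval₂RingHom, ← ht, ← eval₂_reflect_mul_pow _ _ N _ hp, mul_assoc, ← mul_pow,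
    inv_mul_cancel₀ ht0, one_pow, mul_one]
  have h1 : (↑(reflect N p) : PowerSeries k) =
      eval₂ PowerSeries.C PowerSeries.X (reflect N p) := eval₂_C_X_eq_coe.symm
  rw [h1, hom_eval₂]
  rfl

theorem inftyHom_injective : Function.Injective (inftyHom k L) := by
  rw [injective_iff_map_eq_zero]
  intro p hp
  have h2 := inftyHom_mul_pow L (le_refl p.natDegree)
  rw [hp, zero_mul, eq_comm, FaithfulSMul.algebraMap_eq_zero_iff, Polynomial.coe_eq_zero_iff,
    reflect_eq_zero_iff] at h2
  exact h2

theorem exists_scaleRoots_inftyHom_eq {f : k[X][X]} (hmon : f.Monic) {l e : ℕ} (hl : l ≠ 0)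
    (hdeg : f.natDegree = l + 1) (h0 : (f.coeff 0).natDegree + 3 ≤ e * (l + 1))
    (h1 : (f.coeff 1).natDegree + 1 = e * l) (h1' : f.coeff 1 ≠ 0)
    (hcoeff : ∀ i ≤ l, (f.coeff i).natDegree < e * (l + 1 - i)) :
    ∃ (s : L) (h : L[X]), Irreducible h ∧ (f.map (inftyHom k L)).scaleRoots
      (algebraMap (PowerSeries k) L PowerSeries.X ^ e) = (X - C s) * h := by
  let Φ : (PowerSeries k)[X] := X ^ (l + 1) + ∑ i ∈ Finset.range (l + 1),
    C ((reflect (e * (l + 1 - i)) (f.coeff i) : k[X]) : PowerSeries k) * X ^ i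
  have hΦcoeff : ∀ i ≤ l, Φ.coeff i =
      ((reflect (e * (l + 1 - i)) (f.coeff i) : k[X]) : PowerSeries k) := fun i hi => by
    simp only [Φ, coeff_add, coeff_X_pow, finsetSum_coeff, coeff_C_mul]
    rw [if_neg (by omega), zero_add, Finset.sum_eq_single_of_mem i (Finset.mem_range.2 (by omega))]
    · simp
    · intro j _ hj
      simp [hj.symm]
  have hlt : (∑ i ∈ Finset.range (l + 1),
      C ((reflect (e * (l + 1 - i)) (f.coeff i) : k[X]) : PowerSeries k) * X ^ i).degree <
      ((l + 1 : ℕ) : WithBot ℕ) := by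
    refine (degree_sum_le _ _).trans_lt
      ((Finset.sup_lt_iff (WithBot.bot_lt_coe _)).2 fun i hi => ?_)
    refine (degree_C_mul_X_pow_le _ _).trans_lt ?_
    exact_mod_cast Finset.mem_range.1 hi
  have hΦmon : Φ.Monic := monic_X_pow_add hlt
  have hΦdeg : Φ.natDegree = l + 1 := by
    refine natDegree_eq_of_degree_eq_some ?_
    rw [degree_add_eq_left_of_degree_lt (by rwa [degree_X_pow]), degree_X_pow]
  have hpsc : ∀ (p : k[X]) j, PowerSeries.coeff j (p : PowerSeries k) = p.coeff j :=
    fun p j => Polynomial.coeff_coe p j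
  have hrefl : ∀ {N j : ℕ} {p : k[X]}, p.natDegree + j < N → (reflect N p).coeff j = 0 :=
    fun {N j p} h => by
      rw [coeff_reflect, revAt_le (by omega)]
      exact coeff_eq_zero_of_natDegree_lt (by omega)
  obtain ⟨s, h, hfac, hirr⟩ := exists_eq_X_sub_C_mul_irreducible hl hΦmon hΦdeg (by
      rw [hΦcoeff 0 (by omega), PowerSeries.X_pow_dvd_iff]
      intro j hj
      rw [hpsc]
      exact hrefl (by rw [Nat.sub_zero]; omega)) (by
      have h2 : PowerSeries.X ∣ Φ.coeff 1 := by
        rw [hΦcoeff 1 (by omega), PowerSeries.X_dvd_iff,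
          ← PowerSeries.coeff_zero_eq_constantCoeff_apply,
          hpsc]
        exact hrefl (by rw [Nat.add_sub_cancel]; omega)
      obtain ⟨ψ, hψ⟩ := h2
      refine ⟨ψ, ?_, hψ⟩
      rw [← PowerSeries.coeff_zero_eq_constantCoeff_apply, ← PowerSeries.coeff_succ_X_mul, ← hψ,
        hΦcoeff 1 (by omega), hpsc, coeff_reflect, Nat.add_sub_cancel, revAt_le (by omega), ← h1,
        Nat.add_sub_cancel]
      exact leadingCoeff_ne_zero.2 h1') (by
      intro i hi
      rw [hΦcoeff i hi, ← PowerSeries.coeff_zero_eq_constantCoeff_apply, hpsc]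
      exact hrefl (hcoeff i hi)) L
  refine ⟨algebraMap _ L s, h.map (algebraMap _ L), hirr, ?_⟩
  have h2 := congrArg (Polynomial.map (algebraMap (PowerSeries k) L)) hfac
  rw [Polynomial.map_mul, Polynomial.map_sub, map_X, map_C] at h2
  rw [← h2]
  have hdeg' : (f.map (inftyHom k L)).natDegree = l + 1 := by rw [hmon.natDegree_map, hdeg]
  ext i
  rw [coeff_scaleRoots, coeff_map, coeff_map, hdeg']
  rcases lt_trichotomy i (l + 1) with hi | rfl | hi
  · rw [hΦcoeff i (by omega), ← inftyHom_mul_pow L (hcoeff i (by omega)).le, pow_mul]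
  · rw [← hdeg, hmon.coeff_natDegree, hdeg, ← hΦdeg, hΦmon.coeff_natDegree]
    simp
  · rw [coeff_eq_zero_of_natDegree_lt (by omega), coeff_eq_zero_of_natDegree_lt (by omega)]
    simp

end InftyHom

theorem exists_stabilizer_transitive_of_natDegree (L : Type*) [Field L]
    [Algebra (PowerSeries k) L] [IsFractionRing (PowerSeries k) L]
      {K E I : Type*} [Field K] [Algebra k[X] K]
    [IsFractionRing k[X] K] [Field E] [Algebra K E] [Normal K E] [Algebra k[X] E]
    [IsScalarTower k[X] K E] [Fintype I] {f : k[X][X]} {x : I → E} (hx : Function.Injective x)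
    (hf : f.map (algebraMap k[X] E) = ∏ i, (X - C (x i))) (hmon : f.Monic) {l e : ℕ} (hl : l ≠ 0)
    (hdeg : f.natDegree = l + 1) (h0 : (f.coeff 0).natDegree + 3 ≤ e * (l + 1))
    (h1 : (f.coeff 1).natDegree + 1 = e * l) (h1' : f.coeff 1 ≠ 0)
    (hcoeff : ∀ i ≤ l, (f.coeff i).natDegree < e * (l + 1 - i)) :
    ∃ ξ, ∀ i j, i ≠ ξ → j ≠ ξ → ∃ σ : E ≃ₐ[K] E, σ (x ξ) = x ξ ∧ σ (x i) = x j := by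
  let _ : Algebra K L := (IsFractionRing.lift (inftyHom_injective (k := k) L)).toAlgebra
  have hKL : (algebraMap K L).comp (algebraMap k[X] K) = inftyHom k L :=
    RingHom.ext fun p => IsFractionRing.lift_algebraMap (inftyHom_injective (k := k) L) p
  have ht0 : algebraMap (PowerSeries k) L PowerSeries.X ≠ 0 := by
    rw [Ne, FaithfulSMul.algebraMap_eq_zero_iff]
    exact PowerSeries.X_ne_zero
  obtain ⟨s, h, hirr, hfac⟩ := exists_scaleRoots_inftyHom_eq L hmon hl hdeg h0 h1 h1' hcoeff
  refine exists_stabilizer_transitive (K := K) (f := f.map (algebraMap k[X] K)) (L := L) hx ?_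
    (pow_ne_zero e ht0) hirr ((congrArg (fun p : L[X] => p.scaleRoots _) ?_).trans hfac)
  · rw [Polynomial.map_map, ← IsScalarTower.algebraMap_eq, hf]
  · rw [Polynomial.map_map, hKL]

end TwoTransitive

section Irreducible

theorem irreducible_of_scaleRoots_eq {K L : Type*} [Field K] [Field L] [Algebra K L] {f : K[X]}
    (hroot : ∀ r, ¬ f.IsRoot r) {c s : L} {h : L[X]} (hh : Irreducible h)
    (hfac : (f.map (algebraMap K L)).scaleRoots c = (X - C s) * h) : Irreducible f := by
  have hdeg : f.natDegree = 1 + h.natDegree := by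
    rw [← natDegree_map (algebraMap K L), ← natDegree_scaleRoots _ c, hfac,
      (monic_X_sub_C s).natDegree_mul' hh.ne_zero, natDegree_X_sub_C]
  have hf0 : f ≠ 0 := by
    rintro rfl
    exact hroot 0 eval_zero
  have key : ∀ p q : K[X], f = p * q → h ∣ (p.map (algebraMap K L)).scaleRoots c → IsUnit q := by
    rintro p q rfl hdvd
    obtain ⟨hp, hq⟩ := mul_ne_zero_iff.1 hf0
    have h1 := natDegree_le_of_dvd hdvd (scaleRoots_ne_zero (map_ne_zero hp) c)
    rw [natDegree_scaleRoots, natDegree_map] at h1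
    rw [natDegree_mul hp hq] at hdeg
    rw [isUnit_iff_degree_eq_zero, degree_eq_natDegree hq, Nat.cast_eq_zero]
    by_contra hne
    obtain ⟨r, hr⟩ := exists_root_of_degree_eq_one (p := q)
      ((degree_eq_iff_natDegree_eq_of_pos one_pos).2 (by omega))
    exact hroot r (root_mul_left_of_isRoot p hr)
  refine ⟨fun hu => ?_, fun p q hpq => ?_⟩
  · have := natDegree_eq_zero_of_isUnit hu
    omega
  · have hdvd : h ∣ (p.map (algebraMap K L)).scaleRoots c *
      (q.map (algebraMap K L)).scaleRoots c := by
      rw [← mul_scaleRoots_of_noZeroDivisors, ← Polynomial.map_mul, ← hpq, hfac]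
      exact dvd_mul_left _ _
    rcases hh.prime.dvd_or_dvd hdvd with h1 | h1
    · exact Or.inr (key p q hpq h1)
    · exact Or.inl (key q p (hpq.trans (mul_comm p q)) h1)

variable {k : Type*} [Field k]

/-- A monic polynomial over `k[X]` without roots, of degree `l + 1`, whose Newton polygon at
infinity has a segment of width one and another one of slope prime to its width. -/
structure TwoSlopes (f : k[X][X]) (l e : ℕ) : Prop where
  monic : f.Monic
  ne_zero : l ≠ 0
  natDegree_eq : f.natDegree = l + 1
  coeff_zero : (f.coeff 0).natDegree + 3 ≤ e * (l + 1)
  coeff_one : (f.coeff 1).natDegree + 1 = e * l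
  coeff_one_ne_zero : f.coeff 1 ≠ 0
  coeff_lt : ∀ i ≤ l, (f.coeff i).natDegree < e * (l + 1 - i)
  eval_ne_zero : ∀ r : k[X], f.eval r ≠ 0

namespace TwoSlopes

variable {f : k[X][X]} {l e : ℕ} (K : Type*) [Field K] [Algebra k[X] K] [IsFractionRing k[X] K]

theorem exists_stabilizer (hf : TwoSlopes f l e) {E I : Type*}
    [Field E] [Algebra K E] [Normal K E] [Algebra k[X] E]
    [IsScalarTower k[X] K E] [Fintype I] {x : I → E} (hx : Function.Injective x)
    (hfx : f.map (algebraMap k[X] E) = ∏ i, (X - C (x i))) :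
    ∃ ξ, ∀ i j, i ≠ ξ → j ≠ ξ → ∃ σ : E ≃ₐ[K] E, σ (x ξ) = x ξ ∧ σ (x i) = x j :=
  exists_stabilizer_transitive_of_natDegree (FractionRing (PowerSeries k)) hx hfx hf.monic
    hf.ne_zero
    hf.natDegree_eq hf.coeff_zero hf.coeff_one hf.coeff_one_ne_zero hf.coeff_lt

theorem irreducible_aux (hf : TwoSlopes f l e) (L : Type*) [Field L]
    [Algebra (PowerSeries k) L] [IsFractionRing (PowerSeries k) L] :
    Irreducible (f.map (algebraMap k[X] K)) := by
  let _ : Algebra K L := (IsFractionRing.lift (inftyHom_injective (k := k) L)).toAlgebra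
  have hKL : (algebraMap K L).comp (algebraMap k[X] K) = inftyHom k L :=
    RingHom.ext fun p => IsFractionRing.lift_algebraMap (inftyHom_injective (k := k) L) p
  obtain ⟨s, h, hirr, hfac⟩ := exists_scaleRoots_inftyHom_eq L hf.monic hf.ne_zero
    hf.natDegree_eq hf.coeff_zero hf.coeff_one hf.coeff_one_ne_zero hf.coeff_lt
  refine irreducible_of_scaleRoots_eq (fun r hr => ?_) hirr
    ((congrArg (fun p : L[X] => p.scaleRoots _) ?_).trans hfac)
  · rw [IsRoot, eval_map_algebraMap] at hr
    obtain ⟨r', rfl⟩ := isInteger_of_is_root_of_monic hf.monic hr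
    rw [aeval_algebraMap_apply, FaithfulSMul.algebraMap_eq_zero_iff, coe_aeval_eq_eval] at hr
    exact hf.eval_ne_zero r' hr
  · rw [Polynomial.map_map, hKL]

theorem irreducible (hf : TwoSlopes f l e) : Irreducible (f.map (algebraMap k[X] K)) :=
  hf.irreducible_aux K (FractionRing (PowerSeries k))

theorem separable (hf : TwoSlopes f l e) : (f.map (algebraMap k[X] K)).Separable := by
  rw [separable_iff_derivative_ne_zero (hf.irreducible K)]
  intro h
  have h1 := congrArg (fun p => p.coeff 0) h
  simp only [coeff_derivative, coeff_map] at h1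
  simp [hf.coeff_one_ne_zero] at h1

theorem separable_mul (hf : TwoSlopes f l e) {g : k[X][X]} {l' e' : ℕ} (hg : TwoSlopes g l' e')
    (hne : l ≠ l') : ((f * g).map (algebraMap k[X] K)).Separable := by
  rw [Polynomial.map_mul]
  refine (hf.separable K).mul (hg.separable K)
    (((hf.irreducible K).coprime_iff_not_dvd).2 fun hdvd => ?_)
  have h1 := degree_eq_degree_of_associated (associated_of_dvd_dvd hdvd
    (((hf.irreducible K).dvd_symm (hg.irreducible K)) hdvd))
  rw [hf.monic.degree_map, hg.monic.degree_map, degree_eq_natDegree hf.monic.ne_zero,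
    degree_eq_natDegree hg.monic.ne_zero, hf.natDegree_eq, hg.natDegree_eq, Nat.cast_inj] at h1
  omega

theorem exists_algEquiv_apply_eq (hf : TwoSlopes f l e) {E I : Type*}
    [Field E] [Algebra K E] [Normal K E] [Algebra k[X] E]
    [IsScalarTower k[X] K E] [Fintype I] {x : I → E}
    (hfx : f.map (algebraMap k[X] E) = ∏ i, (X - C (x i))) (i j : I) :
    ∃ σ : E ≃ₐ[K] E, σ (x i) = x j := by
  have hroot : ∀ i, aeval (x i) (f.map (algebraMap k[X] K)) = 0 := fun i => by
    rw [aeval_map_algebraMap, ← eval_map_algebraMap, hfx, eval_prod]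
    exact Finset.prod_eq_zero (Finset.mem_univ i) (by simp)
  refine isConjRoot_iff_exists_algEquiv.1 ?_
  rw [isConjRoot_def, ← minpoly.eq_of_irreducible (hf.irreducible K) (hroot i),
    ← minpoly.eq_of_irreducible (hf.irreducible K) (hroot j)]

end TwoSlopes
end Irreducible

section Specialize

variable {k R ι : Type*} [Field k] [CommRing R] [Algebra k[X] R] [Algebra k R]
  [IsScalarTower k k[X] R] [IsDomain R] [Fintype ι] {I J : Type*} [Fintype I] [Fintype J]

theorem exists_perm_pow_eq {p : ℕ} [Fact p.Prime] [CharP k p] {a : ℕ} {f : k[X]} {x : I → k}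
    (hx : Function.Injective x) (hf : f = ∏ i, (X - C (x i)))
    (hfa : f.map (iterateFrobenius k p a) = f) :
    ∃ π : Equiv.Perm I, ∀ i, x i ^ p ^ a = x (π i) := by
  have h : ∀ i, ∃ j, x i ^ p ^ a = x j := fun i => by
    have h1 : f.eval (x i) = 0 := by
      rw [hf, eval_prod]
      exact Finset.prod_eq_zero (Finset.mem_univ i) (by simp)
    have h2 : f.eval (x i ^ p ^ a) = 0 := by
      conv_lhs => rw [← hfa, ← iterateFrobenius_def, eval_map_apply, h1, map_zero]
    rw [hf, eval_prod, Finset.prod_eq_zero_iff] at h2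
    obtain ⟨j, -, hj⟩ := h2
    exact ⟨j, by simpa [sub_eq_zero] using hj⟩
  choose π hπ using h
  have hinj : Function.Injective π := fun i j hij => by
    have h : x i ^ p ^ a = x j ^ p ^ a := by rw [hπ, hπ, hij]
    rw [← iterateFrobenius_def, ← iterateFrobenius_def] at h
    exact hx ((iterateFrobenius k p a).injective h)
  exact ⟨Equiv.ofBijective π (Finite.injective_iff_bijective.1 hinj), hπ⟩

theorem exists_discriminant {x : I → R} (hx : Function.Injective x) :
    ∃ δ : R, δ ≠ 0 ∧ ∀ P : R →ₐ[k] k, P δ ≠ 0 → Function.Injective fun i => P (x i) := by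
  classical
  refine ⟨∏ q ∈ Finset.univ.filter (fun q : I × I => q.1 ≠ q.2), (x q.1 - x q.2), ?_, ?_⟩
  · refine Finset.prod_ne_zero_iff.2 fun q hq => sub_ne_zero.2 fun h => ?_
    exact (Finset.mem_filter.1 hq).2 (hx h)
  · intro P hP i j hij
    by_contra hne
    rw [map_prod, Finset.prod_ne_zero_iff] at hP
    refine hP (i, j) (by simpa using hne) ?_
    simpa [sub_eq_zero] using hij

theorem exists_specialization [IsAlgClosed k] {p : ℕ} [Fact p.Prime] [CharP k p]
    (e : Module.Basis ι k[X] R) [Finite (R ≃ₐ[k[X]] R)]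
    {f g : k[X][X]} {x : I → R} {y : J → R} (hx : Function.Injective x) (hy : Function.Injective y)
    (hf : f.map (algebraMap k[X] R) = ∏ i, (X - C (x i)))
    (hg : g.map (algebraMap k[X] R) = ∏ j, (X - C (y j)))
    (hgen : ∀ σ : R ≃ₐ[k[X]] R, (∀ i, σ (x i) = x i) → (∀ j, σ (y j) = y j) → σ = 1)
    {w : ι → R} (hw : LinearIndependent k[X] w)
    (hwx : ∀ i, w i ∈ Submonoid.closure (Set.range (Sum.elim x y)))
    (htop : ∀ (π : Equiv.Perm I) (ρ : Equiv.Perm J), ∃ σ : R ≃ₐ[k[X]] R,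
      (∀ i, σ (x i) = x (π i)) ∧ ∀ j, σ (y j) = y (ρ j)) {d : ℕ}
    (hfd : ∀ (a : ℕ) (u : k), d ∣ a → u ^ p ^ a = u →
      (f.map (evalRingHom u)).map (iterateFrobenius k p a) = f.map (evalRingHom u))
    (hgd : ∀ (a : ℕ) (u : k), d ∣ a → u ^ p ^ a = u →
      (g.map (evalRingHom u)).map (iterateFrobenius k p a) = g.map (evalRingHom u))
    (π : Equiv.Perm I) (ρ : Equiv.Perm J) :
    ∃ N : ℕ, ∀ a ≥ N, d ∣ a → ∃ (u : k) (ξ : I → k) (η : J → k), u ^ p ^ a = u ∧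
      Function.Injective ξ ∧ Function.Injective η ∧
      f.map (evalRingHom u) = ∏ i, (X - C (ξ i)) ∧ g.map (evalRingHom u) = ∏ j, (X - C (η j)) ∧
      (∀ i, ξ i ^ p ^ a = ξ (π i)) ∧ ∀ j, η j ^ p ^ a = η (ρ j) := by
  obtain ⟨δ₁, hδ₁, hinj₁⟩ := exists_discriminant (k := k) hx
  obtain ⟨δ₂, hδ₂, hinj₂⟩ := exists_discriminant (k := k) hy
  have hinj : ∀ P : R →ₐ[k] k, P (δ₁ * δ₂) ≠ 0 →
      Function.Injective (fun i => P (x i)) ∧ Function.Injective fun j => P (y j) := by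
    intro P hP
    rw [map_mul] at hP
    exact ⟨hinj₁ P (left_ne_zero_of_mul hP), hinj₂ P (right_ne_zero_of_mul hP)⟩
  obtain ⟨σ, hσx, hσy⟩ := htop π ρ
  obtain ⟨N, hN⟩ := exists_point_frobenius (p := p) e hw (Sum.elim x y) hwx (mul_ne_zero hδ₁ hδ₂)
    (fun P hP σ τ hστ => by
      have h : σ⁻¹ * τ = 1 := by
        refine hgen _ (fun i => ?_) (fun j => ?_)
        · obtain ⟨π₁, h₁⟩ := exists_perm_of_map_eq_prod hx hf σ
          obtain ⟨π₂, h₂⟩ := exists_perm_of_map_eq_prod hx hf τ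
          have h := DFunLike.congr_fun hστ (x i)
          rw [twist_apply, twist_apply, h₁, h₂] at h
          rw [AlgEquiv.mul_apply, h₂, ← (hinj P hP).1 h, ← h₁, ← AlgEquiv.mul_apply,
            inv_mul_cancel, AlgEquiv.one_apply]
        · obtain ⟨π₁, h₁⟩ := exists_perm_of_map_eq_prod hy hg σ
          obtain ⟨π₂, h₂⟩ := exists_perm_of_map_eq_prod hy hg τ
          have h := DFunLike.congr_fun hστ (y j)
          rw [twist_apply, twist_apply, h₁, h₂] at h
          rw [AlgEquiv.mul_apply, h₂, ← (hinj P hP).2 h, ← h₁, ← AlgEquiv.mul_apply,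
            inv_mul_cancel, AlgEquiv.one_apply]
      exact (inv_mul_eq_one.1 h))
    (d := d)
    (fun a P hda hP hPa => by
      obtain ⟨π', hπ'⟩ := exists_perm_pow_eq (hinj P hP).1 (map_evalRingHom_eq_prod hf P)
        (hfd a _ hda hPa)
      obtain ⟨ρ', hρ'⟩ := exists_perm_pow_eq (hinj P hP).2 (map_evalRingHom_eq_prod hg P)
        (hgd a _ hda hPa)
      obtain ⟨σ', h₁, h₂⟩ := htop π' ρ'
      refine ⟨σ', ?_⟩
      rintro (i | j)
      · simpa [h₁] using hπ' i
      · simpa [h₂] using hρ' j) σ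
  refine ⟨N, fun a ha hda => ?_⟩
  obtain ⟨P, hδ, hPa, hP⟩ := hN a ha hda
  refine ⟨base P, fun i => P (x i), fun j => P (y j), hPa, (hinj P hδ).1, (hinj P hδ).2,
    map_evalRingHom_eq_prod hf P,
    map_evalRingHom_eq_prod hg P, fun i => ?_, fun j => ?_⟩
  · simpa [hσx] using hP (Sum.inl i)
  · simpa [hσy] using hP (Sum.inr j)

end Specialize

section Generation

variable {A K E R : Type*} [CommRing A] [Field K] [Algebra A K] [IsFractionRing A K] [Field E]
  [Algebra K E] [Algebra A E] [IsScalarTower A K E] [CommRing R] [Algebra R E]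
  [IsIntegralClosure R A E] [Algebra A R] [IsScalarTower A R E]

theorem exists_linearIndependent_monomials [FiniteDimensional K E] {I : Type*} {z : I → R}
    (hz : Algebra.adjoin K (Set.range fun i => algebraMap R E (z i)) = ⊤) :
    ∃ w : Fin (Module.finrank K E) → R, LinearIndependent A w ∧
      ∀ i, w i ∈ Submonoid.closure (Set.range z) := by
  have hspan : Submodule.span K (Submonoid.closure
      (Set.range fun i => algebraMap R E (z i)) : Set E) = ⊤ := by
    rw [← Algebra.adjoin_eq_span, hz, Algebra.top_toSubmodule]
  have hcl : Submonoid.closure (Set.range fun i => algebraMap R E (z i)) =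
      (Submonoid.closure (Set.range z)).map (algebraMap R E) := by
    rw [MonoidHom.map_mclosure, ← Set.range_comp]
    rfl
  obtain ⟨t, ht, hcard, -, hind⟩ := Submodule.exists_finset_span_eq_linearIndepOn K
    (Submonoid.closure (Set.range fun i => algebraMap R E (z i)) : Set E)
  rw [hspan, finrank_top] at hcard
  have hmem : ∀ i : t, ∃ r ∈ Submonoid.closure (Set.range z), algebraMap R E r = i := fun i => by
    have := ht i.2
    rwa [hcl] at this
  choose w hw hwt using hmem
  have hind' : LinearIndependent A w := by
    refine LinearIndependent.of_comp (IsScalarTower.toAlgHom A R E).toLinearMap ?_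
    have h : LinearIndependent K (fun i : t => (i : E)) := hind
    convert! h.restrict_scalars' A using 2 with i
    exact hwt i
  exact ⟨w ∘ (t.equivFinOfCardEq hcard).symm,
    hind'.comp _ (t.equivFinOfCardEq hcard).symm.injective, fun i => hw _⟩

theorem eq_one_of_forall_apply_eq [IsIntegrallyClosed A] [FiniteDimensional K E] {I : Type*}
    {z : I → R}
    (hz : Algebra.adjoin K (Set.range fun i => algebraMap R E (z i)) = ⊤)
    (σ : R ≃ₐ[A] R) (hσ : ∀ i, σ (z i) = z i) : σ = 1 := by
  have h : (galRestrict A K E R).symm σ = 1 := by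
    refine AlgEquiv.ext fun v => DFunLike.congr_fun (AlgHom.ext_of_adjoin_eq_top hz
      (φ₁ := ((galRestrict A K E R).symm σ : E →ₐ[K] E)) (φ₂ := AlgHom.id K E) ?_) v
    rintro _ ⟨i, rfl⟩
    simpa [hσ] using galRestrict_symm_algebraMap_apply A K σ (z i)
  simpa using h

theorem exists_map_eq_prod {f : A[X]} (hf : f.Monic) (hsep : (f.map (algebraMap A E)).Separable)
    (hsplit : (f.map (algebraMap A E)).Splits) :
    ∃ x : Fin f.natDegree → R, Function.Injective x ∧
      f.map (algebraMap A R) = ∏ i, (X - C (x i)) := by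
  classical
  have hinj := IsIntegralClosure.algebraMap_injective R A E
  have hnd := nodup_roots hsep
  have hprod := hsplit.eq_prod_roots_of_monic (hf.map _)
  have hcard : (f.map (algebraMap A E)).roots.toFinset.card = f.natDegree := by
    rw [Multiset.toFinset_card_of_nodup hnd, ← hsplit.natDegree_eq_card_roots, hf.natDegree_map]
  have hintegral : ∀ a : (f.map (algebraMap A E)).roots.toFinset, ∃ r, algebraMap R E r = a :=
    fun a => by
    refine (IsIntegralClosure.isIntegral_iff (A := R) (R := A)).1 ⟨f, hf, ?_⟩
    have := (mem_roots'.1 (Multiset.mem_toFinset.1 a.2)).2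
    rwa [IsRoot, eval_map] at this
  choose r hr using hintegral
  have hrinj : Function.Injective r := fun a b h => Subtype.ext (by rw [← hr, ← hr, h])
  refine ⟨r ∘ (Finset.equivFinOfCardEq hcard).symm,
    hrinj.comp (Finset.equivFinOfCardEq hcard).symm.injective, map_injective _ hinj ?_⟩
  rw [Polynomial.map_map, ← IsScalarTower.algebraMap_eq, Polynomial.map_prod]
  conv_lhs => rw [hprod]
  refine Eq.trans ?_ (Equiv.prod_comp (Finset.equivFinOfCardEq hcard).symm
    (fun a => (X - C (r a)).map (algebraMap R E))).symm
  simp only [Polynomial.map_sub, map_X, map_C, hr]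
  rw [Finset.prod_coe_sort _ fun a : E => X - C a, Finset.prod_multiset_map_count]
  refine (Finset.prod_congr rfl fun a ha => ?_)
  rw [Multiset.count_eq_one_of_mem hnd (Multiset.mem_toFinset.1 ha), pow_one]

end Generation

/-- Over some point, `f` has exactly one double root and no other multiple root, the ramification
there is simple, and `g` is unramified. -/
def SimpleBranch {k : Type*} [Field k] (f g : k[X][X]) : Prop :=
  ∃ (u a : k) (B : k[X]), f.map (evalRingHom u) = (X - C a) ^ 2 * B ∧ B.Separable ∧ B.eval a ≠ 0 ∧
    (f.eval (C a)).derivative.eval u ≠ 0 ∧ (g.map (evalRingHom u)).Separable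

/-- The pairs of permutations of two families which are induced by automorphisms. -/
def realized {A R I J : Type*} [CommRing A] [CommRing R] [Algebra A R] (x : I → R) (y : J → R) :
    Subgroup (Equiv.Perm I × Equiv.Perm J) where
  carrier := {h | ∃ σ : R ≃ₐ[A] R, (∀ i, σ (x i) = x (h.1 i)) ∧ ∀ j, σ (y j) = y (h.2 j)}
  one_mem' := ⟨1, fun _ => rfl, fun _ => rfl⟩
  mul_mem' := by
    rintro h h' ⟨σ, hσ, hσ'⟩ ⟨τ, hτ, hτ'⟩
    exact ⟨σ * τ, fun i => by simp [hτ, hσ], fun j => by simp [hτ', hσ']⟩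
  inv_mem' := by
    rintro h ⟨σ, hσ, hσ'⟩
    refine ⟨σ⁻¹, fun i => ?_, fun j => ?_⟩
    · rw [AlgEquiv.aut_inv, AlgEquiv.symm_apply_eq, hσ]; simp
    · rw [AlgEquiv.aut_inv, AlgEquiv.symm_apply_eq, hσ']; simp

theorem exists_specialization_of_twoSlopes_aux
    {k : Type*} [Field k] [IsAlgClosed k] (K E R : Type*) [CommRing R] [IsDomain R]
    [Algebra k[X] R] [Field K] [Algebra k[X] K] [IsFractionRing k[X] K] [Field E] [Algebra K E]
    [Algebra k[X] E] [IsScalarTower k[X] K E] [Algebra R E]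
    [IsIntegralClosure R k[X] E] [IsScalarTower k[X] R E]
    {p : ℕ} [Fact p.Prime] [CharP k p] {f g : k[X][X]} {l e e' : ℕ}
    (hf : TwoSlopes f l e) (hg : TwoSlopes g (l + 1) e') (hfg : SimpleBranch f g)
    (hgf : l = 1 ∨ SimpleBranch g f) {d : ℕ}
    (hfd : ∀ (a : ℕ) (u : k), d ∣ a → u ^ p ^ a = u →
      (f.map (evalRingHom u)).map (iterateFrobenius k p a) = f.map (evalRingHom u))
    (hgd : ∀ (a : ℕ) (u : k), d ∣ a → u ^ p ^ a = u →
      (g.map (evalRingHom u)).map (iterateFrobenius k p a) = g.map (evalRingHom u))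
    [IsSplittingField K E ((f * g).map (algebraMap k[X] K))]
    (π : Equiv.Perm (Fin f.natDegree)) (ρ : Equiv.Perm (Fin g.natDegree)) :
    ∃ N : ℕ, ∀ a ≥ N, d ∣ a → ∃ (u : k) (ξ : Fin f.natDegree → k) (η : Fin g.natDegree → k),
      u ^ p ^ a = u ∧
      Function.Injective ξ ∧ Function.Injective η ∧
      f.map (evalRingHom u) = ∏ i, (X - C (ξ i)) ∧ g.map (evalRingHom u) = ∏ j, (X - C (η j)) ∧
      (∀ i, ξ i ^ p ^ a = ξ (π i)) ∧ ∀ j, η j ^ p ^ a = η (ρ j) := by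
  let _ : Algebra k R := ((algebraMap k[X] R).comp C).toAlgebra
  have _ : IsScalarTower k k[X] R := .of_algebraMap_eq fun _ => rfl
  have hsep := hf.separable_mul K hg (by simp)
  have hfgm := hf.monic.mul hg.monic
  have hgal : IsGalois K E := IsGalois.of_separable_splitting_field hsep
  have hfin : FiniteDimensional K E :=
    IsSplittingField.finiteDimensional E ((f * g).map (algebraMap k[X] K))
  have hinj := IsIntegralClosure.algebraMap_injective R k[X] E
  have hmapE : ∀ h : k[X][X], h.map (algebraMap k[X] E) =
      (h.map (algebraMap k[X] K)).map (algebraMap K E) := fun h => by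
    rw [Polynomial.map_map, ← IsScalarTower.algebraMap_eq]
  have hsplit := IsSplittingField.splits E ((f * g).map (algebraMap k[X] K))
  have hne : ((f * g).map (algebraMap k[X] K)).map (algebraMap K E) ≠ 0 :=
    ((hfgm.map _).map _).ne_zero
  obtain ⟨x, hx, hfx⟩ := exists_map_eq_prod (R := R) (E := E) hf.monic
    (by rw [hmapE]; exact (hf.separable K).map)
    (by
      rw [hmapE]
      exact hsplit.of_dvd hne (Polynomial.map_dvd _ (Polynomial.map_dvd _ (dvd_mul_right f g))))
  obtain ⟨y, hy, hgy⟩ := exists_map_eq_prod (R := R) (E := E) hg.monic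
    (by rw [hmapE]; exact (hg.separable K).map)
    (by
      rw [hmapE]
      exact hsplit.of_dvd hne (Polynomial.map_dvd _ (Polynomial.map_dvd _ (dvd_mul_left g f))))
  have hprodE : ∀ {h : k[X][X]} {I : Type} [Fintype I] {z : I → R},
      h.map (algebraMap k[X] R) = ∏ i, (X - C (z i)) →
      h.map (algebraMap k[X] E) = ∏ i, (X - C (algebraMap R E (z i))) := by
    intro h I _ z hz
    rw [IsScalarTower.algebraMap_eq k[X] R E, ← Polynomial.map_map, hz, Polynomial.map_prod]
    simp
  have hfxE := hprodE hfx
  have hgyE := hprodE hgy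
  have hadj : Algebra.adjoin K (Set.range fun i => algebraMap R E (Sum.elim x y i)) = ⊤ := by
    rw [← IsSplittingField.adjoin_rootSet E ((f * g).map (algebraMap k[X] K))]
    congr 1
    ext v
    rw [mem_rootSet', and_iff_right hne, aeval_map_algebraMap, map_mul, mul_eq_zero,
      ← eval_map_algebraMap, ← eval_map_algebraMap, hfxE, hgyE, eval_prod, eval_prod,
      Finset.prod_eq_zero_iff, Finset.prod_eq_zero_iff]
    simp [sub_eq_zero, @eq_comm _ v]
  obtain ⟨w, hw, hwx⟩ := exists_linearIndependent_monomials (A := k[X]) hadj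
  have hgen : ∀ σ : R ≃ₐ[k[X]] R, (∀ i, σ (x i) = x i) → (∀ j, σ (y j) = y j) → σ = 1 :=
    fun σ h₁ h₂ => eq_one_of_forall_apply_eq hadj σ (by rintro (i | j) <;> simp [h₁, h₂])
  have htf : Module.IsTorsionFree k[X] E := by
    have := (FaithfulSMul.algebraMap_injective K E).comp (IsFractionRing.injective k[X] K)
    rw [← RingHom.coe_comp, ← IsScalarTower.algebraMap_eq] at this
    exact Module.isTorsionFree_iff_algebraMap_injective.2 this
  have hfree : Module.Free k[X] R := IsIntegralClosure.module_free k[X] K E R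
  have hfinite : Module.Finite k[X] R := IsIntegralClosure.finite k[X] K E R
  have b : Module.Basis (Fin (Module.finrank K E)) k[X] R :=
    Module.finBasisOfFinrankEq _ _ (IsIntegralClosure.rank k[X] K E R)
  let res := galRestrict k[X] K E R
  have hres : ∀ σ v, algebraMap R E (res σ v) = σ (algebraMap R E v) := fun σ v =>
    algebraMap_galRestrict_apply _ σ v
  have : Finite (R ≃ₐ[k[X]] R) := Finite.of_equiv _ res.toEquiv
  have := Fintype.ofFinite (R ≃ₐ[k[X]] R)
  have hcard : Fintype.card (R ≃ₐ[k[X]] R) = Fintype.card (Fin (Module.finrank K E)) := by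
    rw [Fintype.card_fin, ← IsGalois.card_aut_eq_finrank, ← Nat.card_eq_fintype_card]
    exact (Nat.card_congr res.toEquiv).symm
  have hmem : ∀ σ : R ≃ₐ[k[X]] R, ∃ h ∈ realized (A := k[X]) x y,
      (∀ i, σ (x i) = x (h.1 i)) ∧ ∀ j, σ (y j) = y (h.2 j) := fun σ => by
    obtain ⟨π₁, h₁⟩ := exists_perm_of_map_eq_prod hx hfx σ
    obtain ⟨π₂, h₂⟩ := exists_perm_of_map_eq_prod hy hgy σ
    exact ⟨(π₁, π₂), ⟨σ, h₁, h₂⟩, h₁, h₂⟩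
  have htop : realized (A := k[X]) x y = ⊤ := by
    obtain ⟨ξ, hξ⟩ := hf.exists_stabilizer K (hinj.comp hx) hfxE
    obtain ⟨η, hη⟩ := hg.exists_stabilizer K (hinj.comp hy) hgyE
    refine subgroup_prod_perm_eq_top (ξ := ξ) (η := η) ?_ ?_ ?_ ?_ ?_ ?_
    · intro i j
      obtain ⟨σ, hσ⟩ := hf.exists_algEquiv_apply_eq K hfxE i j
      obtain ⟨h, hh, h₁, h₂⟩ := hmem (res σ)
      exact ⟨h, hh, hx (by rw [← h₁]; exact hinj ((hres _ _).trans hσ))⟩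
    · intro i j hi hj
      obtain ⟨σ, hσ, hσ'⟩ := hξ i j hi hj
      obtain ⟨h, hh, h₁, h₂⟩ := hmem (res σ)
      exact ⟨h, hh, hx (by rw [← h₁]; exact hinj ((hres _ _).trans hσ)),
        hx (by rw [← h₁]; exact hinj ((hres _ _).trans hσ'))⟩
    · intro i j
      obtain ⟨σ, hσ⟩ := hg.exists_algEquiv_apply_eq K hgyE i j
      obtain ⟨h, hh, h₁, h₂⟩ := hmem (res σ)
      exact ⟨h, hh, hy (by rw [← h₂]; exact hinj ((hres _ _).trans hσ))⟩
    · intro i j hi hj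
      obtain ⟨σ, hσ, hσ'⟩ := hη i j hi hj
      obtain ⟨h, hh, h₁, h₂⟩ := hmem (res σ)
      exact ⟨h, hh, hy (by rw [← h₂]; exact hinj ((hres _ _).trans hσ)),
        hy (by rw [← h₂]; exact hinj ((hres _ _).trans hσ'))⟩
    · obtain ⟨u, a, B, hu, hB, ha, hu', hsepu⟩ := hfg
      obtain ⟨σ, τ, hτ, h₁, h₂⟩ :=
        exists_algEquiv_isSwap b hcard hx hy hfx hgy hgen hu hB ha hu' hsepu
      exact ⟨τ, hτ, σ, h₁, h₂⟩
    · refine hgf.imp (fun h => ?_) fun h => ?_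
      · rw [Fintype.card_fin, hg.natDegree_eq, h]
      · obtain ⟨u, a, B, hu, hB, ha, hu', hsepu⟩ := h
        obtain ⟨σ, τ, hτ, h₁, h₂⟩ :=
          exists_algEquiv_isSwap b hcard hy hx hgy hfx (fun σ h h' => hgen σ h' h) hu hB ha hu'
            hsepu
        exact ⟨(1, τ), ⟨σ, h₂, h₁⟩, hτ⟩
  exact exists_specialization b hx hy hfx hgy hgen hw hwx
    (fun π ρ => (htop.symm ▸ Subgroup.mem_top (π, ρ) : (π, ρ) ∈ realized (A := k[X]) x y)) hfd hgd
      π ρ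

theorem exists_specialization_of_twoSlopes {k : Type*} [Field k] [IsAlgClosed k] {p : ℕ}
    [Fact p.Prime] [CharP k p] {f g : k[X][X]} {l e e' : ℕ}
    (hf : TwoSlopes f l e) (hg : TwoSlopes g (l + 1) e') (hfg : SimpleBranch f g)
    (hgf : l = 1 ∨ SimpleBranch g f) {d : ℕ}
    (hfd : ∀ (a : ℕ) (u : k), d ∣ a → u ^ p ^ a = u →
      (f.map (evalRingHom u)).map (iterateFrobenius k p a) = f.map (evalRingHom u))
    (hgd : ∀ (a : ℕ) (u : k), d ∣ a → u ^ p ^ a = u →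
      (g.map (evalRingHom u)).map (iterateFrobenius k p a) = g.map (evalRingHom u))
    (π : Equiv.Perm (Fin f.natDegree)) (ρ : Equiv.Perm (Fin g.natDegree)) :
    ∃ N : ℕ, ∀ a ≥ N, d ∣ a → ∃ (u : k) (ξ : Fin f.natDegree → k) (η : Fin g.natDegree → k),
      u ^ p ^ a = u ∧
      Function.Injective ξ ∧ Function.Injective η ∧
      f.map (evalRingHom u) = ∏ i, (X - C (ξ i)) ∧ g.map (evalRingHom u) = ∏ j, (X - C (η j)) ∧
      (∀ i, ξ i ^ p ^ a = ξ (π i)) ∧ ∀ j, η j ^ p ^ a = η (ρ j) :=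
  exists_specialization_of_twoSlopes_aux
    (FractionRing k[X]) (((f * g).map (algebraMap k[X] (FractionRing k[X]))).SplittingField)
    (integralClosure k[X] (((f * g).map (algebraMap k[X] (FractionRing k[X]))).SplittingField)) hf
      hg hfg hgf hfd hgd π ρ

theorem irreducible_of_pow_eq_add_one {K k : Type*} [Field K] [Fintype K] [Field k] [IsAlgClosed k]
    (i : K →+* k) {m : ℕ} [NeZero m] {h : K[X]} {ξ : Fin m → k} (hξ : Function.Injective ξ)
    (hh : h.map i = ∏ j, (X - C (ξ j))) (hpow : ∀ j, ξ j ^ Fintype.card K = ξ (j + 1)) :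
    Irreducible h := by
  classical
  have hmon : h.Monic := by
    rw [← Polynomial.monic_map_iff (f := i), hh]
    exact monic_prod_of_monic _ _ fun j _ => monic_X_sub_C _
  have hdeg : h.natDegree = m := by
    rw [← natDegree_map (f := i), hh, natDegree_prod_of_monic _ _ fun j _ => monic_X_sub_C _]
    simp
  obtain ⟨r, hrmon, hr, hrh⟩ := exists_monic_irreducible_factor h fun hu => by
    have := natDegree_eq_zero_of_isUnit hu
    exact NeZero.ne m (hdeg.symm.trans this)
  have hr0 : r.map i ≠ 0 := (hrmon.map i).ne_zero
  obtain ⟨z, hz⟩ := IsAlgClosed.exists_root (r.map i) (by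
    rw [degree_map]
    exact hr.degree_pos.ne')
  have hstep : ∀ z, (r.map i).eval z = 0 → (r.map i).eval (z ^ Fintype.card K) = 0 := fun z hz => by
    rw [eval_map] at hz ⊢
    rw [eval₂_eq_sum_range] at hz ⊢
    obtain ⟨p, hp⟩ := CharP.exists K
    have hprime : p.Prime := CharP.char_is_prime K p
    have : Fact p.Prime := ⟨hprime⟩
    have : CharP k p := charP_of_injective_ringHom i.injective p
    obtain ⟨n, -, hn⟩ := FiniteField.card K p
    have h := congrArg (iterateFrobenius k p n) hz
    rw [map_sum, map_zero] at h
    rw [← h]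
    refine Finset.sum_congr rfl fun j _ => ?_
    rw [iterateFrobenius_def, ← hn, mul_pow, ← map_pow, FiniteField.pow_card, ← pow_mul, ← pow_mul,
      mul_comm j]
  obtain ⟨j, rfl⟩ : ∃ j, ξ j = z := by
    have h1 : (h.map i).eval z = 0 :=
      eval_eq_zero_of_dvd_of_eval_eq_zero (Polynomial.map_dvd i hrh) hz
    rw [hh, eval_prod, Finset.prod_eq_zero_iff] at h1
    obtain ⟨j, -, hj⟩ := h1
    exact ⟨j, by simpa [sub_eq_zero, eq_comm] using hj⟩
  have hall : ∀ n : ℕ, (r.map i).eval (ξ (j + Fin.ofNat m n)) = 0 := fun n => by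
    induction n with
    | zero => simpa using hz
    | succ n ih =>
      have := hstep _ ih
      rwa [hpow, add_assoc, show Fin.ofNat m n + 1 = Fin.ofNat m (n + 1) from ?_] at this
      ext
      simp [Fin.val_add]
  have hle : Finset.univ.image ξ ⊆ (r.map i).roots.toFinset := by
    intro v hv
    obtain ⟨j', -, rfl⟩ := Finset.mem_image.1 hv
    rw [Multiset.mem_toFinset, mem_roots hr0]
    have := hall (j' - j).val
    rwa [Fin.ofNat_val_eq_self, add_sub_cancel] at this
  have hcard := (Finset.card_le_card hle).trans
    ((Multiset.toFinset_card_le _).trans (card_roots' _))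
  rw [Finset.card_image_of_injective _ hξ, Finset.card_fin, natDegree_map, ← hdeg] at hcard
  rwa [eq_of_monic_of_dvd_of_natDegree_le hrmon hmon hrh hcard]

theorem exists_irreducible_specialization {k Fq : Type*} [Field Fq] [Fintype Fq] [Field k]
    [IsAlgClosed k] [Algebra Fq k] {p d : ℕ} [Fact p.Prime] [CharP k p]
    (hd : Fintype.card Fq = p ^ d) {f g : Fq[X][X]} {m n : ℕ} [NeZero m] [NeZero n]
    (h : ∀ (π : Equiv.Perm (Fin m)) (ρ : Equiv.Perm (Fin n)),
      ∃ N : ℕ, ∀ a ≥ N, d ∣ a → ∃ (u : k) (ξ : Fin m → k) (η : Fin n → k),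
      u ^ p ^ a = u ∧ Function.Injective ξ ∧ Function.Injective η ∧
      f.map (aeval u).toRingHom = ∏ i, (X - C (ξ i)) ∧
      g.map (aeval u).toRingHom = ∏ j, (X - C (η j)) ∧
      (∀ i, ξ i ^ p ^ a = ξ (π i)) ∧ ∀ j, η j ^ p ^ a = η (ρ j)) :
    ∃ s₀ : ℕ, ∀ s : ℕ, s₀ ≤ s → ∀ (K : Type) [Field K] [Fintype K] [Algebra Fq K],
      Fintype.card K = Fintype.card Fq ^ s → ∃ v : K,
        Irreducible (f.map (aeval (R := Fq) v).toRingHom) ∧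
        Irreducible (g.map (aeval (R := Fq) v).toRingHom) := by
  classical
  have hd0 : d ≠ 0 := by
    rintro rfl
    exact Fintype.one_lt_card.ne' (hd.trans (pow_zero p))
  obtain ⟨N, hN⟩ := h (Equiv.addRight 1) (Equiv.addRight 1)
  refine ⟨N + 1, fun s hs K _ _ _ hK => ?_⟩
  have ha : N ≤ d * s := by nlinarith [Nat.pos_of_ne_zero hd0]
  obtain ⟨u, ξ, η, hu, hξ, hη, hfu, hgu, hξa, hηa⟩ := hN (d * s) ha (dvd_mul_right d s)
  have hK' : Fintype.card K = p ^ (d * s) := by rw [hK, hd, pow_mul]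
  have : Algebra.IsAlgebraic Fq K := Algebra.IsAlgebraic.of_finite Fq K
  let i : K →ₐ[Fq] k := IsAlgClosed.lift
  obtain ⟨U, hU, hU'⟩ := exists_finset_pow_eq_self k p (a := d * s) (mul_ne_zero hd0 (by omega))
  obtain ⟨v, hv⟩ : ∃ v : K, i v = u := by
    have heq : Finset.univ.image i = U := by
      refine Finset.eq_of_subset_of_card_le (fun x hx => ?_) ?_
      · obtain ⟨y, -, rfl⟩ := Finset.mem_image.1 hx
        rw [hU', ← map_pow, ← hK', FiniteField.pow_card]
      · rw [Finset.card_image_of_injective _ (show Function.Injective i from RingHom.injective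
          (i : K →+* k)), hU, ← hK', Finset.card_univ]
    have := (hU' u).2 hu
    rw [← heq] at this
    obtain ⟨v, -, hv⟩ := Finset.mem_image.1 this
    exact ⟨v, hv⟩
  have hcomp : (i : K →+* k).comp (aeval (R := Fq) v).toRingHom = (aeval u).toRingHom := by
    have : i.comp (aeval (R := Fq) v) = aeval u := by ext; simp [hv]
    exact congrArg AlgHom.toRingHom this
  refine ⟨v, irreducible_of_pow_eq_add_one (i : K →+* k) hξ ?_ fun j => ?_,
    irreducible_of_pow_eq_add_one (i : K →+* k) hη ?_ fun j => ?_⟩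
  · rw [Polynomial.map_map, hcomp, hfu]
  · rw [hK', hξa]; rfl
  · rw [Polynomial.map_map, hcomp, hgu]
  · rw [hK', hηa]; rfl

theorem exists_irreducible_of_twoSlopes {k Fq : Type*} [Field Fq] [Fintype Fq] [Field k]
    [IsAlgClosed k] [Algebra Fq k] {f g : Fq[X][X]} {l e e' : ℕ}
    (hf : TwoSlopes (f.map (mapRingHom (algebraMap Fq k))) l e)
    (hg : TwoSlopes (g.map (mapRingHom (algebraMap Fq k))) (l + 1) e')
    (hfg : SimpleBranch (f.map (mapRingHom (algebraMap Fq k)))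
      (g.map (mapRingHom (algebraMap Fq k))))
    (hgf : l = 1 ∨ SimpleBranch (g.map (mapRingHom (algebraMap Fq k)))
      (f.map (mapRingHom (algebraMap Fq k)))) :
    ∃ s₀ : ℕ, ∀ s : ℕ, s₀ ≤ s → ∀ (K : Type) [Field K] [Fintype K] [Algebra Fq K],
      Fintype.card K = Fintype.card Fq ^ s → ∃ v : K,
        Irreducible (f.map (aeval (R := Fq) v).toRingHom) ∧
        Irreducible (g.map (aeval (R := Fq) v).toRingHom) := by
  obtain ⟨p, hp⟩ := CharP.exists Fq
  have : Fact p.Prime := ⟨CharP.char_is_prime Fq p⟩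
  have : CharP k p := charP_of_injective_algebraMap' Fq p
  obtain ⟨d, -, hd⟩ := FiniteField.card Fq p
  have hlift : ∀ (h : Fq[X][X]) (u : k), (h.map (mapRingHom (algebraMap Fq k))).map (evalRingHom u)
    =
      h.map (aeval u).toRingHom := fun h u => by
    rw [Polynomial.map_map]
    congr 1
    refine Polynomial.ringHom_ext (fun a => ?_) ?_ <;> simp
  have hfix : ∀ (h : Fq[X][X]) (a : ℕ) (u : k), (d : ℕ) ∣ a → u ^ p ^ a = u →
      ((h.map (mapRingHom (algebraMap Fq k))).map (evalRingHom u)).map (iterateFrobenius k p a) =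
        (h.map (mapRingHom (algebraMap Fq k))).map (evalRingHom u) := by
    rintro h _ u ⟨s, rfl⟩ hu
    rw [hlift, Polynomial.map_map]
    congr 1
    refine Polynomial.ringHom_ext (fun c => ?_) ?_
    · simp [iterateFrobenius_def, pow_mul, ← hd, ← map_pow, FiniteField.pow_card_pow]
    · simpa [iterateFrobenius_def] using hu
  have : NeZero (f.map (mapRingHom (algebraMap Fq k))).natDegree := ⟨by simp [hf.natDegree_eq]⟩
  have : NeZero (g.map (mapRingHom (algebraMap Fq k))).natDegree := ⟨by simp [hg.natDegree_eq]⟩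
  refine exists_irreducible_specialization (k := k)
    (m := (f.map (mapRingHom (algebraMap Fq k))).natDegree)
    (n := (g.map (mapRingHom (algebraMap Fq k))).natDegree) hd fun π ρ => ?_
  simp only [← hlift]
  exact exists_specialization_of_twoSlopes hf hg hfg hgf (hfix f) (hfix g) π ρ

section Points

open IntermediateField

variable {k Fq : Type*} [Field Fq] [Fintype Fq] [Field k] [Algebra Fq k]
  [Algebra.IsAlgebraic Fq k]

theorem exists_subset_adjoin_simple (T : Finset k) : ∃ u : k, ∀ c ∈ T, c ∈ Fq⟮u⟯ := by
  have : FiniteDimensional Fq (adjoin Fq (T : Set k)) :=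
    finiteDimensional_adjoin fun x _ => Algebra.IsIntegral.isIntegral x
  have : Finite (adjoin Fq (T : Set k)) := Module.finite_of_finite Fq
  obtain ⟨u, hu⟩ := Field.exists_primitive_element_of_finite_top Fq (adjoin Fq (T : Set k))
  refine ⟨u, fun c hc => ?_⟩
  have h := congrArg (IntermediateField.map (adjoin Fq (T : Set k)).val) hu
  rw [adjoin_map, Set.image_singleton, ← AlgHom.fieldRange_eq_map, fieldRange_val] at h
  have : c ∈ adjoin Fq (T : Set k) := subset_adjoin _ _ hc
  rwa [← h] at this

theorem exists_aeval_eq_of_mem {u c : k} (hc : c ∈ Fq⟮u⟯) : ∃ r : Fq[X], aeval u r = c := by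
  rw [← mem_toSubalgebra, adjoin_simple_toSubalgebra_of_isAlgebraic
    (Algebra.IsAlgebraic.isAlgebraic u), Algebra.adjoin_singleton_eq_range_aeval] at hc
  exact hc

theorem exists_interpolation_points [Infinite k] (T : Finset k) : ∃ (u v : k) (P : Fq[X]), P ≠ 0 ∧
    aeval u P = 0 ∧ aeval v P = 0 ∧ aeval u (derivative P) ≠ 0 ∧ aeval v (derivative P) ≠ 0 ∧
    ∀ c ∈ T, ∀ c' ∈ T, ∃ r : Fq[X], aeval u r = c ∧ aeval v r = c' := by
  classical
  obtain ⟨u, hu⟩ := exists_subset_adjoin_simple (Fq := Fq) T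
  have hfin : ∀ u : k, FiniteDimensional Fq Fq⟮u⟯ := fun u =>
    adjoin.finiteDimensional (Algebra.IsIntegral.isIntegral u)
  have : Finite Fq⟮u⟯ := Module.finite_of_finite Fq
  obtain ⟨z, hz⟩ := (Set.toFinite (Fq⟮u⟯ : Set k)).infinite_compl.nonempty
  obtain ⟨v, hv⟩ := exists_subset_adjoin_simple (Fq := Fq) (insert u (insert z T))
  have hle : Fq⟮u⟯ ≤ Fq⟮v⟯ := adjoin_simple_le_iff.2 (hv u (by simp))
  have hne : minpoly Fq u ≠ minpoly Fq v := fun h => by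
    refine hz ?_
    have := eq_of_le_of_finrank_eq hle (by
      rw [adjoin.finrank (Algebra.IsIntegral.isIntegral u),
        adjoin.finrank (Algebra.IsIntegral.isIntegral v), h])
    rw [this]
    exact hv z (by simp)
  have hiu := minpoly.irreducible (Algebra.IsIntegral.isIntegral (R := Fq) u)
  have hiv := minpoly.irreducible (Algebra.IsIntegral.isIntegral (R := Fq) v)
  have hcop : IsCoprime (minpoly Fq u) (minpoly Fq v) := by
    refine hiu.coprime_iff_not_dvd.2 fun hdvd => hne ?_
    exact eq_of_monic_of_associated (minpoly.monic (Algebra.IsIntegral.isIntegral u))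
      (minpoly.monic (Algebra.IsIntegral.isIntegral v))
      (associated_of_dvd_dvd hdvd ((hiu.dvd_symm hiv) hdvd))
  have hsep : (minpoly Fq u * minpoly Fq v).Separable :=
    (PerfectField.separable_of_irreducible hiu).mul (PerfectField.separable_of_irreducible hiv) hcop
  have hu0 : aeval u (minpoly Fq u * minpoly Fq v) = 0 := by simp
  have hv0 : aeval v (minpoly Fq u * minpoly Fq v) = 0 := by simp
  refine ⟨u, v, _, mul_ne_zero hiu.ne_zero hiv.ne_zero, hu0, hv0,
    hsep.aeval_derivative_ne_zero hu0, hsep.aeval_derivative_ne_zero hv0, fun c hc c' hc' => ?_⟩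
  obtain ⟨r, rfl⟩ := exists_aeval_eq_of_mem (hu c hc)
  obtain ⟨s, rfl⟩ := exists_aeval_eq_of_mem (hv c' (by simp [hc']))
  obtain ⟨a, b, hab⟩ := hcop
  refine ⟨s * (a * minpoly Fq u) + r * (b * minpoly Fq v), ?_, ?_⟩
  · have := congrArg (aeval u) hab
    simp only [map_add, map_mul, minpoly.aeval, mul_zero, zero_add, map_one] at this ⊢
    rw [this, mul_one]
  · have := congrArg (aeval v) hab
    simp only [map_add, map_mul, minpoly.aeval, mul_zero, add_zero, map_one] at this ⊢
    rw [this, mul_one]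

end Points

theorem TwoSlopes.of_natDegree_lt {k : Type*} [Field k] {f : k[X][X]} {l e M : ℕ} (hf : f.Monic)
    (hl : l ≠ 0) (hdeg : f.natDegree = l + 1)
    (hM : ∀ i ≤ l, i ≠ 1 → (f.coeff i).natDegree < M) (h1 : (f.coeff 1).natDegree + 1 = e * l)
    (h0 : f.coeff 0 ≠ 0) (he : (l + 2) * M + 3 ≤ e) : TwoSlopes f l e := by
  have hel : e ≤ e * l := Nat.le_mul_of_pos_right e (Nat.pos_of_ne_zero hl)
  have h0M := hM 0 (Nat.zero_le l) (by simp)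
  have hlM : M ≤ (l + 1) * M := Nat.le_mul_of_pos_left M (by omega)
  have hM2 : (l + 2) * M = (l + 1) * M + M := by ring
  have h1ne : f.coeff 1 ≠ 0 := by
    intro h
    rw [h, natDegree_zero] at h1
    omega
  refine ⟨hf, hl, hdeg, ?_, h1, h1ne, fun i hi => ?_, fun r hr => ?_⟩
  · rw [mul_add, mul_one]
    omega
  · by_cases hi1 : i = 1
    · subst hi1
      rw [Nat.add_sub_cancel]
      omega
    · have := hM i hi hi1
      have h : e ≤ e * (l + 1 - i) := Nat.le_mul_of_pos_right e (by omega)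
      omega
  · have hr0 : r ∣ f.coeff 0 := by
      have := sub_dvd_eval_sub r 0 f
      rwa [hr, sub_zero, zero_sub, dvd_neg, ← coeff_zero_eq_eval_zero] at this
    have hrne : r ≠ 0 := by
      rintro rfl
      exact h0 (zero_dvd_iff.1 hr0)
    have hrM : r.natDegree < M := (natDegree_le_of_dvd hr0 h0).trans_lt h0M
    rw [eval_eq_sum_range, hdeg, ← Finset.add_sum_erase _ _ (Finset.mem_range.2
      (by omega : 1 < l + 1 + 1)),
      add_eq_zero_iff_eq_neg] at hr
    have hle : (f.coeff 1 * r ^ 1).natDegree ≤ (l + 1) * M := by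
      rw [hr, natDegree_neg]
      refine natDegree_sum_le_of_forall_le _ _ fun i hi => ?_
      obtain ⟨hi1, hi⟩ := Finset.mem_erase.1 hi
      rw [Finset.mem_range] at hi
      have hpow : (r ^ i).natDegree ≤ i * M :=
        natDegree_pow_le.trans (Nat.mul_le_mul_left i hrM.le)
      refine natDegree_mul_le.trans ?_
      obtain hil | rfl : i ≤ l ∨ i = l + 1 := by omega
      · have := hM i hil hi1
        have h : (i + 1) * M ≤ (l + 1) * M := Nat.mul_le_mul_right M (by omega)
        rw [add_mul, one_mul] at h
        omega
      · rw [← hdeg, hf.coeff_natDegree, natDegree_one, zero_add, hdeg]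
        exact hpow
    rw [pow_one, natDegree_mul h1ne hrne] at hle
    omega

section Construction

variable {k Fq : Type*} [Field Fq] [Fintype Fq] [Field k] [Algebra Fq k]
  [Algebra.IsAlgebraic Fq k]

/-- The polynomial `t ^ m + ∑_{i < m} c i t ^ i`. -/
noncomputable def monicOf {A : Type*} [CommRing A] (m : ℕ) (c : ℕ → A) : A[X] :=
  X ^ m + ∑ i ∈ Finset.range m, C (c i) * X ^ i

section

variable {A B : Type*} [CommRing A] [CommRing B] {m : ℕ}

theorem coeff_monicOf (c : ℕ → A) {i : ℕ} (hi : i < m) : (monicOf m c).coeff i = c i := by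
  simp [monicOf, coeff_X_pow, hi.ne, finsetSum_coeff, hi]

theorem degree_sum_lt (c : ℕ → A) :
    (∑ i ∈ Finset.range m, C (c i) * X ^ i).degree < (m : WithBot ℕ) := by
  rw [Finset.sum_congr rfl fun i _ => (C_mul_X_pow_eq_monomial (a := c i) (n := i))]
  refine (degree_sum_le _ _).trans_lt ((Finset.sup_lt_iff (WithBot.bot_lt_coe m)).2 fun i hi => ?_)
  exact (degree_monomial_le i _).trans_lt (Nat.cast_lt.2 (Finset.mem_range.1 hi))

theorem monic_monicOf (c : ℕ → A) : (monicOf m c).Monic :=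
  monic_X_pow_add (degree_sum_lt c)

theorem natDegree_monicOf [Nontrivial A] (c : ℕ → A) : (monicOf m c).natDegree = m := by
  refine natDegree_eq_of_degree_eq_some ?_
  rw [monicOf, degree_add_eq_left_of_degree_lt, degree_X_pow]
  rw [degree_X_pow]
  exact degree_sum_lt c

theorem map_monicOf (φ : A →+* B) (c : ℕ → A) : (monicOf m c).map φ =
    monicOf m fun i => φ (c i) := by
  simp [monicOf, Polynomial.map_sum]

theorem monicOf_coeff {f : A[X]} (hf : f.Monic) (hm : f.natDegree = m) : monicOf m f.coeff = f := by
  rw [monicOf, ← hm, ← hf.as_sum]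

end

theorem exists_add_mul_ne_zero (hcard : 2 < Fintype.card Fq) {s t s' t' : k} (ht : t ≠ 0)
    (ht' : t' ≠ 0) : ∃ b : Fq, s + algebraMap Fq k b * t ≠ 0 ∧ s' + algebraMap Fq k b * t' ≠ 0 := by
  classical
  by_contra! h
  have hsub : Finset.univ.image (algebraMap Fq k) ⊆ {-s / t, -s' / t'} := by
    intro z hz
    obtain ⟨b, -, rfl⟩ := Finset.mem_image.1 hz
    rw [Finset.mem_insert, Finset.mem_singleton, eq_div_iff ht, eq_div_iff ht',
      eq_neg_iff_add_eq_zero,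
      eq_neg_iff_add_eq_zero, add_comm _ s, add_comm _ s']
    exact or_iff_not_imp_left.2 (h b)
  have := (Finset.card_le_card hsub).trans Finset.card_le_two
  rw [Finset.card_image_of_injective _ (algebraMap Fq k).injective, Finset.card_univ] at this
  omega

theorem exists_family [Infinite k] (hcard : 2 < Fintype.card Fq) {l : ℕ} (hl : l ≠ 0) (A D : k[X])
    (a a' : k) : ∃ (c : ℕ → Fq[X]) (u v : k) (M H : ℕ),
      (∀ i ≤ l, aeval u (c i) = A.coeff i ∧ aeval v (c i) = D.coeff i) ∧
      ∑ i ∈ Finset.range (l + 1), aeval u (derivative (c i)) * a ^ i ≠ 0 ∧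
      ∑ i ∈ Finset.range (l + 1), aeval v (derivative (c i)) * a' ^ i ≠ 0 ∧
      (∀ i ≤ l, i ≠ 1 → (c i).natDegree < M) ∧ (c 0).natDegree ≠ 0 ∧
      (c 1).natDegree + 1 = (l + 1) * l * H ∧ (l + 3) * M + 3 ≤ H := by
  classical
  obtain ⟨u, v, P, hP, huP, hvP, huP', hvP', hintegral⟩ := exists_interpolation_points (Fq := Fq)
    ((Finset.range (l + 1)).image A.coeff ∪ (Finset.range (l + 1)).image D.coeff)
  have hr : ∀ i, ∃ r : Fq[X], i ≤ l → aeval u r = A.coeff i ∧ aeval v r = D.coeff i := fun i => by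
    by_cases hi : i ≤ l
    · obtain ⟨r, hr⟩ := hintegral (A.coeff i)
        (Finset.mem_union_left _ (Finset.mem_image_of_mem _ (Finset.mem_range.2 (by omega))))
        (D.coeff i)
        (Finset.mem_union_right _ (Finset.mem_image_of_mem _ (Finset.mem_range.2 (by omega))))
      exact ⟨r, fun _ => hr⟩
    · exact ⟨0, fun h => absurd h hi⟩
  choose r hr using hr
  obtain ⟨b, hbu, hbv⟩ := exists_add_mul_ne_zero hcard
    (s := ∑ i ∈ Finset.range (l + 1), aeval u (derivative (r i)) * a ^ i)
    (s' := ∑ i ∈ Finset.range (l + 1), aeval v (derivative (r i)) * a' ^ i) huP' hvP'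
  obtain ⟨j, hj⟩ : ∃ j, j = (r 0).natDegree + P.natDegree + 1 := ⟨_, rfl⟩
  obtain ⟨M, hM⟩ : ∃ M, M = 2 * P.natDegree + j + 1 +
    ∑ i ∈ Finset.range (l + 1), (r i).natDegree := ⟨_, rfl⟩
  obtain ⟨H, hH⟩ : ∃ H, H = (l + 3) * M + 3 := ⟨_, rfl⟩
  have hrM : ∀ i ≤ l, 2 * P.natDegree + (r i).natDegree < M := fun i hi => by
    have := Finset.single_le_sum (f := fun i => (r i).natDegree) (fun _ _ => Nat.zero_le _)
      (Finset.mem_range.2 (by omega : i < l + 1))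
    omega
  have hMH : M < H := by nlinarith
  have hHl : H ≤ (l + 1) * l * H := Nat.le_mul_of_pos_left H (by positivity)
  obtain ⟨j', hj'⟩ : ∃ j', 2 * P.natDegree + j' + 1 = (l + 1) * l * H :=
    ⟨(l + 1) * l * H - 1 - 2 * P.natDegree, by have := hrM 0 (Nat.zero_le l); omega⟩
  have hdeg : ∀ j, (P ^ 2 * X ^ j).natDegree = 2 * P.natDegree + j := fun j => by
    rw [natDegree_mul (pow_ne_zero 2 hP) (pow_ne_zero j X_ne_zero), natDegree_pow, natDegree_X_pow]
  let E : ℕ → Fq[X] := fun i => if i = 0 then C b * P + P ^ 2 * X ^ j else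
    if i = 1 then P ^ 2 * X ^ j' else 0
  have hE0 : E 0 = C b * P + P ^ 2 * X ^ j := rfl
  have hE1 : E 1 = P ^ 2 * X ^ j' := rfl
  have hEi : ∀ i, i ≠ 0 → i ≠ 1 → E i = 0 := fun i h0 h1 => by simp [E, h0, h1]
  have hEz : ∀ z : k, aeval z P = 0 → ∀ i, aeval z (E i) = 0 ∧
      aeval z (derivative (E i)) =
        if i = 0 then algebraMap Fq k b * aeval z (derivative P) else 0 := by
    intro z hz i
    by_cases h0 : i = 0
    · subst h0
      rw [hE0]
      simp [hz, derivative_mul, derivative_pow]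
    by_cases h1 : i = 1
    · subst h1
      rw [hE1]
      simp [hz, derivative_mul, derivative_pow]
    · simp [hEi i h0 h1, h0]
  have hsum : ∀ z x : k, aeval z P = 0 →
      ∑ i ∈ Finset.range (l + 1), aeval z (derivative (r i + E i)) * x ^ i =
      ∑ i ∈ Finset.range (l + 1), aeval z (derivative (r i)) * x ^ i +
        algebraMap Fq k b * aeval z (derivative P) := fun z x hz => by
    simp [derivative_add, (hEz z hz _).2, add_mul, Finset.sum_add_distrib]
  have hc0 : (r 0 + E 0).natDegree = 2 * P.natDegree + j := by
    rw [hE0, ← add_assoc, natDegree_add_eq_right_of_natDegree_lt, hdeg]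
    rw [hdeg]
    refine (natDegree_add_le _ _).trans_lt (max_lt (by omega) ?_)
    exact (natDegree_C_mul_le b P).trans_lt (by omega)
  have hc1 : (r 1 + E 1).natDegree = 2 * P.natDegree + j' := by
    have := hrM 1 (Nat.one_le_iff_ne_zero.2 hl)
    rw [hE1, natDegree_add_eq_right_of_natDegree_lt, hdeg]
    rw [hdeg]
    omega
  refine ⟨fun i => r i + E i, u, v, M, H, fun i hi => ?_, ?_, ?_, fun i hi hi1 => ?_, ?_, ?_, hH.ge⟩
  · rw [map_add, map_add, (hEz u huP i).1, (hEz v hvP i).1, add_zero, add_zero]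
    exact hr i hi
  · rwa [hsum u a huP]
  · rwa [hsum v a' hvP]
  · by_cases hi0 : i = 0
    · subst hi0
      rw [hc0]
      omega
    · have := hrM i hi
      simp only [hEi i hi0 hi1, add_zero]
      omega
  · rw [hc0]
    omega
  · rw [hc1, hj']

end Construction

theorem monicOf_congr {A : Type*} [CommRing A] {m : ℕ} {c c' : ℕ → A} (h : ∀ i < m, c i = c' i) :
    monicOf m c = monicOf m c' := by
  rw [monicOf, monicOf, Finset.sum_congr rfl fun i hi => by rw [h i (Finset.mem_range.1 hi)]]

theorem eval_derivative_eval_monicOf {k : Type*} [Field k] {m : ℕ} (c : ℕ → k[X]) (a u : k) :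
    ((monicOf m c).eval (C a)).derivative.eval u =
      ∑ i ∈ Finset.range m, (derivative (c i)).eval u * a ^ i := by
  have h : ∀ i, derivative (C a ^ i : k[X]) = 0 := fun i => by rw [← C_pow, derivative_C]
  simp [monicOf, eval_finsetSum, derivative_mul, h]

/-- A degeneration of `A` to a polynomial with one double root such that `A'` is separable. -/
def DoubleRoot {k : Type*} [Field k] (A A' : k[X]) (a : k) : Prop :=
  ∃ B : k[X], A = (X - C a) ^ 2 * B ∧ B.Separable ∧ B.eval a ≠ 0 ∧ A'.Separable

theorem monic_map_C_sub_monicOf {S : Type*} [Field S] {l : ℕ} (r : ℕ → S[X]) {Q : S[X]}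
    (hQ : Q.Monic) (hQdeg : Q.natDegree = l + 2) :
    (Q.map C - monicOf (l + 1) r).Monic ∧ (Q.map C - monicOf (l + 1) r).natDegree = l + 2 := by
  have hlt : (monicOf (l + 1) r).degree < (Q.map (C : S →+* S[X])).degree := by
    rw [degree_eq_natDegree (monic_monicOf r).ne_zero, natDegree_monicOf,
      degree_eq_natDegree (hQ.map _).ne_zero, hQ.natDegree_map, hQdeg]
    exact Nat.cast_lt.2 (by omega)
  refine ⟨(hQ.map C).sub_of_left hlt, ?_⟩
  rw [natDegree_sub_eq_left_of_natDegree_lt (natDegree_lt_natDegree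
    (monic_monicOf r).ne_zero hlt), hQ.natDegree_map, hQdeg]

theorem exists_goldbach {k Fq : Type*} [Field Fq] [Fintype Fq] [Field k] [IsAlgClosed k]
    [Algebra Fq k] [Algebra.IsAlgebraic Fq k] (hcard : 2 < Fintype.card Fq) {F : Fq[X]}
    (hF : F.Monic) {l : ℕ} (hl : l ≠ 0) (hdeg : F.natDegree = l + 2) {A D : k[X]} {a a' : k}
    (hA : A.Monic) (hAdeg : A.natDegree = l + 1) (hD : D.Monic) (hDdeg : D.natDegree = l + 1)
    (hAa : DoubleRoot A (F.map (algebraMap Fq k) - A) a)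
    (hDa : l = 1 ∨ DoubleRoot (F.map (algebraMap Fq k) - D) D a') :
    ∃ s₀ : ℕ, ∀ s : ℕ, s₀ ≤ s → ∀ (K : Type) [Field K] [Fintype K] [Algebra Fq K],
      Fintype.card K = Fintype.card Fq ^ s → ∃ F₁ F₂ : K[X],
        F₁.Monic ∧ Irreducible F₁ ∧ F₁.natDegree = l + 1 ∧
        F₂.Monic ∧ Irreducible F₂ ∧ F₂.natDegree = l + 2 ∧
        F.map (algebraMap Fq K) = F₁ + F₂ := by
  have : Infinite k := IsAlgClosed.instInfinite
  obtain ⟨c, u, v, M, H, hc, hu, hv, hM, h0, h1, hH⟩ := exists_family hcard hl A D a a'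
  have hM0 := hM 0 (Nat.zero_le l) (by simp)
  let φ := algebraMap Fq k
  let c' : ℕ → k[X] := fun i => (c i).map φ
  have hc' : ∀ i, (c' i).natDegree = (c i).natDegree := fun i => natDegree_map φ
  have hFk : (F.map φ).Monic := hF.map φ
  have hFkdeg : (F.map φ).natDegree = l + 2 := by rw [natDegree_map, hdeg]
  let g' : k[X][X] := (F.map φ).map C - monicOf (l + 1) c'
  have hlf : (monicOf (l + 1) c).map (mapRingHom φ) = monicOf (l + 1) c' := map_monicOf _ _
  have hlg : (F.map C - monicOf (l + 1) c).map (mapRingHom φ) = g' := by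
    rw [Polynomial.map_sub, hlf, Polynomial.map_map, mapRingHom_comp_C, ← Polynomial.map_map]
  have hgcoeff : ∀ i, i ≤ l → g'.coeff i = C ((F.map φ).coeff i) - c' i := fun i hi => by
    rw [coeff_sub, coeff_map, coeff_monicOf _ (by omega)]
  have hf2 : TwoSlopes ((monicOf (l + 1) c).map (mapRingHom φ)) l ((l + 1) * H) := by
    rw [hlf]
    refine .of_natDegree_lt (M := M) (monic_monicOf _) hl (natDegree_monicOf _) (fun i hi hi1 => ?_)
      ?_ (fun h => ?_) ?_
    · rw [coeff_monicOf _ (by omega), hc']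
      exact hM i hi hi1
    · rw [coeff_monicOf _ (by omega), hc', h1]
      ring
    · rw [coeff_monicOf _ (by omega)] at h
      exact h0 (by rw [← hc', h, natDegree_zero])
    · nlinarith
  have hg2 : TwoSlopes ((F.map C - monicOf (l + 1) c).map (mapRingHom φ)) (l + 1) (l * H) := by
    rw [hlg]
    have hgnat : ∀ i ≤ l, (g'.coeff i).natDegree = (c i).natDegree := fun i hi => by
      rw [hgcoeff i hi, ← hc', natDegree_sub, natDegree_sub_C]
    refine .of_natDegree_lt (M := M) (monic_map_C_sub_monicOf c' hFk hFkdeg).1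
      l.succ_ne_zero (monic_map_C_sub_monicOf c' hFk hFkdeg).2
      (fun i hi hi1 => ?_) ?_ (fun h => ?_) ?_
    · obtain hi | rfl : i ≤ l ∨ i = l + 1 := by omega
      · rw [hgnat i hi]
        exact hM i hi hi1
      · have : g'.coeff (l + 1) = C ((F.map φ).coeff (l + 1) - 1) := by
          have h := (monic_monicOf (m := l + 1) c').coeff_natDegree
          rw [natDegree_monicOf] at h
          rw [coeff_sub, coeff_map, h, C_sub, C_1]
        rw [this, natDegree_C]
        omega
    · rw [hgnat 1 (by omega), h1]
      ring
    · exact h0 (by rw [← hgnat 0 (by omega), h, natDegree_zero])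
    · have : H ≤ l * H := Nat.le_mul_of_pos_left H (Nat.pos_of_ne_zero hl)
      nlinarith
  have hspec : ∀ (z : k) (Q : k[X]), Q.Monic → Q.natDegree = l + 1 →
      (∀ i ≤ l, aeval z (c i) = Q.coeff i) → (monicOf (l + 1) c').map (evalRingHom z) = Q ∧
        g'.map (evalRingHom z) = F.map φ - Q := by
    intro z Q hQ hQdeg hz
    have h : (monicOf (l + 1) c').map (evalRingHom z) = Q := by
      rw [map_monicOf]
      refine (monicOf_congr fun i hi => ?_).trans (monicOf_coeff hQ hQdeg)
      rw [← hz i (by omega), coe_evalRingHom, eval_map_algebraMap]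
    refine ⟨h, ?_⟩
    rw [Polynomial.map_sub, h, Polynomial.map_map,
      show (evalRingHom z).comp C = RingHom.id k by ext; simp, Polynomial.map_id]
  have hder : ∀ z x : k, ((monicOf (l + 1) c').eval (C x)).derivative.eval z =
      ∑ i ∈ Finset.range (l + 1), aeval z (derivative (c i)) * x ^ i := fun z x => by
    rw [eval_derivative_eval_monicOf]
    refine Finset.sum_congr rfl fun i _ => ?_
    rw [derivative_map, eval_map_algebraMap]
  have hfg : SimpleBranch ((monicOf (l + 1) c).map (mapRingHom φ))
      ((F.map C - monicOf (l + 1) c).map (mapRingHom φ)) := by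
    obtain ⟨B, hAB, hB, hBa, hsep⟩ := hAa
    obtain ⟨h, h'⟩ := hspec u A hA hAdeg fun i hi => (hc i hi).1
    rw [hlf, hlg]
    refine ⟨u, a, B, h.trans hAB, hB, hBa, ?_, h' ▸ hsep⟩
    rwa [hder]
  have hgf : l = 1 ∨ SimpleBranch ((F.map C - monicOf (l + 1) c).map (mapRingHom φ))
      ((monicOf (l + 1) c).map (mapRingHom φ)) := by
    refine hDa.imp_right fun ⟨B, hDB, hB, hBa, hsep⟩ => ?_
    obtain ⟨h, h'⟩ := hspec v D hD hDdeg fun i hi => (hc i hi).2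
    rw [hlf, hlg]
    refine ⟨v, a', B, h'.trans hDB, hB, hBa, ?_, h.symm ▸ hsep⟩
    rw [eval_sub, eval_map, eval₂_at_apply, derivative_sub, derivative_C, zero_sub, eval_neg, hder]
    exact neg_ne_zero.2 hv
  obtain ⟨s₀, hs₀⟩ := exists_irreducible_of_twoSlopes hf2 hg2 hfg hgf
  refine ⟨s₀, fun s hs K _ _ _ hK => ?_⟩
  obtain ⟨z, hz₁, hz₂⟩ := hs₀ s hs K hK
  refine ⟨_, _, (monic_monicOf c).map _, hz₁, ?_,
    (monic_map_C_sub_monicOf c hF hdeg).1.map _, hz₂, ?_, ?_⟩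
  · rw [(monic_monicOf c).natDegree_map, natDegree_monicOf]
  · rw [(monic_map_C_sub_monicOf c hF hdeg).1.natDegree_map, (monic_map_C_sub_monicOf c hF hdeg).2]
  · rw [Polynomial.map_sub, add_sub_cancel, Polynomial.map_map]
    congr 1
    ext
    simp

theorem separable_of_forall_eval_ne_zero {k : Type*} [Field k] [IsAlgClosed k] {P : k[X]}
    (h : ∀ x, P.eval x = 0 → P.derivative.eval x ≠ 0) : P.Separable := by
  rw [separable_def, isCoprime_iff_aeval_ne_zero_of_isAlgClosed k k]
  intro x
  simpa [coe_aeval_eq_eval, or_iff_not_imp_left] using h x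

theorem exists_doubleRoot_sub {k : Type*} [Field k] [IsAlgClosed k] (h2 : (2 : k) ≠ 0) {F : k[X]}
    (hF : F.Monic) {e : ℕ} (hdeg : F.natDegree = e + 3) :
    ∃ (A : k[X]) (a : k), A.Monic ∧ A.natDegree = e + 2 ∧ DoubleRoot A (F - A) a := by
  have : Infinite k := IsAlgClosed.instInfinite
  obtain ⟨s, hs, hscard⟩ :=
    (finite_setOfPred_isRoot hF.ne_zero).infinite_compl.exists_subset_card_eq e
  have hFs : ∀ x ∈ s, F.eval x ≠ 0 := fun x hx h => hs hx h
  let B : k[X] := ∏ b ∈ s, (X - C b)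
  have hB : B.Monic := monic_prod_of_monic _ _ fun b _ => monic_X_sub_C b
  have hBdeg : B.natDegree = e := by
    rw [natDegree_prod_of_monic _ _ fun b _ => monic_X_sub_C b]
    simp [hscard]
  have hBsep : B.Separable := separable_prod_X_sub_C_iff'.2 fun x _ y _ h => h
  have hFB : ∀ x, B.eval x = 0 → F.eval x ≠ 0 := fun x hx => by
    rw [eval_prod, Finset.prod_eq_zero_iff] at hx
    obtain ⟨b, hb, h⟩ := hx
    rw [eval_sub, eval_X, eval_C, sub_eq_zero] at h
    exact h ▸ hFs b hb
  let W : k[X] := (derivative F * B - F * derivative B) ^ 2 - C 4 * (F * B ^ 3)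
  have h4 : (4 : k) ≠ 0 := by
    rw [show (4 : k) = 2 * 2 by norm_num]
    exact mul_ne_zero h2 h2
  have hW : W ≠ 0 := fun h => by
    have h := congrArg natDegree (sub_eq_zero.1 h)
    rw [natDegree_pow, natDegree_C_mul h4, hF.natDegree_mul (hB.pow 3), hB.natDegree_pow, hdeg,
      hBdeg] at h
    omega
  have hfin : ((⋃ x ∈ {x | W.IsRoot x},
      {a | (x - a) ^ 2 = F.eval x / B.eval x}) ∪ {x | B.IsRoot x}).Finite := by
    refine .union (.biUnion (finite_setOfPred_isRoot hW) fun x _ => ?_)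
      (finite_setOfPred_isRoot hB.ne_zero)
    obtain ⟨w, hw⟩ := IsAlgClosed.exists_pow_nat_eq (F.eval x / B.eval x) two_pos
    refine (Set.toFinite {x - w, x + w}).subset fun a (ha : _ = _) => ?_
    rw [← hw, sq_eq_sq_iff_eq_or_eq_neg] at ha
    obtain h | h := ha
    · exact Or.inl (by linear_combination -h)
    · exact Or.inr (by simpa using show a = x + w by linear_combination -h)
  obtain ⟨a, ha⟩ := hfin.infinite_compl.nonempty
  rw [Set.mem_compl_iff, Set.mem_union, not_or] at ha
  refine ⟨(X - C a) ^ 2 * B, a, ((monic_X_sub_C a).pow 2).mul hB, ?_, B, rfl, hBsep,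
    fun h => ha.2 h, separable_of_forall_eval_ne_zero fun x h h' => ?_⟩
  · rw [((monic_X_sub_C a).pow 2).natDegree_mul hB, (monic_X_sub_C a).natDegree_pow, hBdeg,
      natDegree_X_sub_C]
    ring
  · have h₁ : F.eval x = (x - a) ^ 2 * B.eval x := by
      simpa [sub_eq_zero] using h
    have h₂ : F.derivative.eval x =
        2 * (x - a) * B.eval x + (x - a) ^ 2 * B.derivative.eval x := by
      simpa [sub_eq_zero, derivative_mul, derivative_X_sub_C_sq] using h'
    have hBx : B.eval x ≠ 0 := fun h => hFB x h (by rw [h₁, h, mul_zero])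
    refine ha.1 (Set.mem_biUnion (x := x) ?_ ?_)
    · rw [Set.mem_ofPred_eq, IsRoot.def]
      simp only [W, eval_sub, eval_mul, eval_pow, eval_C]
      rw [h₁, h₂]
      ring
    · rw [Set.mem_ofPred_eq, h₁, mul_div_cancel_right₀ _ hBx]

theorem exists_sub_doubleRoot {k : Type*} [Field k] [IsAlgClosed k] (h2 : (2 : k) ≠ 0) {F : k[X]}
    (hF : F.Monic) {d : ℕ} (hdeg : F.natDegree = d + 4) :
    ∃ (D : k[X]) (a : k), D.Monic ∧ D.natDegree = d + 3 ∧ DoubleRoot (F - D) D a := by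
  have : Infinite k := IsAlgClosed.instInfinite
  obtain ⟨a, ha⟩ := ((finite_setOfPred_isRoot hF.ne_zero).union
    (Set.finite_singleton ((1 - F.coeff (d + 3)) / 2))).infinite_compl.nonempty
  rw [Set.mem_compl_iff, Set.mem_union, not_or, Set.mem_singleton_iff] at ha
  have hFa : F.eval a ≠ 0 := fun h => ha.1 h
  let b := 2 * a + F.coeff (d + 3) - 1
  have hb : b ≠ 0 := fun h => ha.2 (by rw [eq_div_iff h2]; linear_combination h)
  let B : k[X] := X ^ (d + 2) + C b * X ^ (d + 1)
  have hB : derivative B ≠ 0 := fun h => by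
    have h₁ := congrArg (coeff · (d + 1)) h
    have h₀ := congrArg (coeff · d) h
    simp only [coeff_derivative, coeff_zero, B, coeff_add, coeff_C_mul, coeff_X_pow] at h₁ h₀
    simp [hb] at h₁ h₀
    exact one_ne_zero (α := k) (by linear_combination h₁ - h₀)
  let G := F - (X - C a) ^ 2 * B
  let V := derivative G * (X - C a) - C 2 * G
  have hVa : V.eval a ≠ 0 := by simp [V, G, h2, hFa]
  have hV : V ≠ 0 := fun h => hVa (by rw [h, eval_zero])
  have hfin : (((fun x => -B.eval x) '' {x | (derivative B).IsRoot x}) ∪ {-B.eval a} ∪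
      ((fun x => G.eval x / (x - a) ^ 2) '' {x | V.IsRoot x})).Finite :=
    (((finite_setOfPred_isRoot hB).image _).union (Set.finite_singleton _)).union
      ((finite_setOfPred_isRoot hV).image _)
  obtain ⟨β, hβ⟩ := hfin.infinite_compl.nonempty
  simp only [Set.mem_compl_iff, Set.mem_union, not_or, Set.mem_singleton_iff, Set.mem_image,
    not_exists, not_and, Set.mem_ofPred_eq, IsRoot.def] at hβ
  obtain ⟨⟨hβB, hβa⟩, hβV⟩ := hβ
  let R := F - X ^ (d + 4) - C (F.coeff (d + 3)) * X ^ (d + 3)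
  have hR : R.natDegree ≤ d + 2 := by
    rw [natDegree_le_iff_coeff_eq_zero]
    intro i hi
    obtain rfl | rfl | hi : i = d + 3 ∨ i = d + 4 ∨ d + 4 < i := by omega
    · simp [R, coeff_X_pow]
    · have := hF.coeff_natDegree
      rw [hdeg] at this
      simp [R, coeff_X_pow, this]
    · have := coeff_eq_zero_of_natDegree_lt (hdeg.trans_lt hi)
      simp [R, coeff_X_pow, this, hi.ne', show i ≠ d + 3 by omega]
  have hD : F - (X - C a) ^ 2 * (B + C β) = X ^ (d + 3) +
    (R - (C (a ^ 2 - 2 * a * b) * X ^ (d + 2) +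
      C (a ^ 2 * b) * X ^ (d + 1) + C β * (X - C a) ^ 2)) := by
    simp only [R, B, b, C_sub, C_mul, C_add, C_pow, C_1, C_ofNat]
    ring
  have hr : (R - (C (a ^ 2 - 2 * a * b) * X ^ (d + 2) +
      C (a ^ 2 * b) * X ^ (d + 1) + C β * (X - C a) ^ 2)).degree < ((d + 3 : ℕ) : WithBot ℕ) := by
    refine degree_le_natDegree.trans_lt (Nat.cast_lt.2 (Nat.lt_succ_of_le ?_))
    compute_degree!
  refine ⟨F - (X - C a) ^ 2 * (B + C β), a, ?_, ?_, B + C β, by ring,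
    separable_of_forall_eval_ne_zero fun x h h' => ?_, fun h => hβa ?_,
    separable_of_forall_eval_ne_zero fun x h h' => ?_⟩
  · rw [hD]
    exact monic_X_pow_add hr
  · rw [hD]
    rw [natDegree_add_eq_left_of_degree_lt (by rwa [degree_X_pow]), natDegree_X_pow]
  · rw [derivative_add, derivative_C, add_zero] at h'
    rw [eval_add, eval_C] at h
    exact hβB x h' (by linear_combination -h)
  · rw [eval_add, eval_C] at h
    linear_combination h
  · have hDG : F - (X - C a) ^ 2 * (B + C β) = G - C β * (X - C a) ^ 2 := by
      simp only [G]
      ring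
    rw [hDG] at h h'
    have h₁ : G.eval x = β * (x - a) ^ 2 := by
      simpa [sub_eq_zero] using h
    have h₂ : G.derivative.eval x = β * (2 * (x - a)) := by
      simpa [sub_eq_zero, derivative_mul, derivative_X_sub_C_sq] using h'
    have hVx : V.eval x = 0 := by
      simp only [V, eval_sub, eval_mul, eval_C, eval_X]
      rw [h₁, h₂]
      ring
    have hxa : x - a ≠ 0 := fun h => hVa (sub_eq_zero.1 h ▸ hVx)
    exact hβV x hVx (by rw [h₁, mul_div_cancel_right₀ _ (pow_ne_zero 2 hxa)])

theorem exists_goldbach_of_natDegree_eq_two {K : Type*} [Field K] [Fintype K]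
    (hK : ringChar K ≠ 2) {F : K[X]} (hF : F.Monic) (hdeg : F.natDegree = 2) :
    ∃ F₁ F₂ : K[X], F₁.Monic ∧ Irreducible F₁ ∧ F₁.natDegree = 1 ∧
      F₂.Monic ∧ Irreducible F₂ ∧ F₂.natDegree = 2 ∧ F = F₁ + F₂ := by
  obtain ⟨w, hw⟩ := FiniteField.exists_nonsquare hK
  have h2 : (2 : K) ≠ 0 := Ring.two_ne_zero hK
  have h4 : (4 : K) ≠ 0 := by
    rw [show (4 : K) = 2 * 2 by norm_num]
    exact mul_ne_zero h2 h2
  let c := F.coeff 0 - ((F.coeff 1 - 1) ^ 2 - w) / 4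
  have hlt : (X + C c).natDegree < F.natDegree := by rw [natDegree_X_add_C, hdeg]; norm_num
  have hG : (F - (X + C c)).Monic :=
    hF.sub_of_left (degree_lt_degree hlt)
  have hGdeg : (F - (X + C c)).natDegree = 2 := by
    rw [natDegree_sub_eq_left_of_natDegree_lt hlt, hdeg]
  refine ⟨X + C c, F - (X + C c), monic_X_add_C c, irreducible_of_degree_eq_one (degree_X_add_C c),
    natDegree_X_add_C c, hG, ?_, hGdeg, by ring⟩
  rw [hG.irreducible_iff_roots_eq_zero_of_degree_le_three hGdeg.ge (by omega),
    Multiset.eq_zero_iff_forall_notMem]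
  intro x hx
  have hx := (mem_roots'.1 hx).2
  have hFx : F.eval x = F.coeff 0 + F.coeff 1 * x + x ^ 2 := by
    have := hF.coeff_natDegree
    rw [hdeg] at this
    rw [eval_eq_sum_range, hdeg]
    simp [Finset.sum_range_succ, this]
  rw [IsRoot.def, eval_sub, hFx, eval_add, eval_X, eval_C] at hx
  refine hw ⟨2 * x + F.coeff 1 - 1, ?_⟩
  have hc : 4 * c = 4 * F.coeff 0 - ((F.coeff 1 - 1) ^ 2 - w) := by
    simp only [c]
    field_simp
  linear_combination -4 * hx - hc

end Goldbach

/-- **Theorem A.**  Let `F_q` be a fixed finite field of odd cardinality `q`, and let `F` be a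
monic polynomial in `F_q[t]` of degree `n ≥ 2`.  Then there is `s₀` such that for every
`s ≥ s₀` and every finite field `K ⊇ F_q` with `#K = q^s`, the image of `F` in `K[t]` has a
Goldbach representation: `F = F₁ + F₂` with `F₁, F₂ ∈ K[t]` monic irreducible of respective
degrees `n−1` and `n`. -/
theorem goldbach_large_extension (Fq : Type) [Field Fq] [Fintype Fq]
    (hodd : Odd (Fintype.card Fq)) (n : ℕ) (hn : 2 ≤ n)
    (F : Polynomial Fq) (hF : F.Monic) (hdeg : F.natDegree = n) :
    ∃ s₀ : ℕ, ∀ s : ℕ, s₀ ≤ s →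
      ∀ (K : Type) [Field K] [Fintype K] [Algebra Fq K],
        Fintype.card K = Fintype.card Fq ^ s →
        ∃ F₁ F₂ : Polynomial K,
          F₁.Monic ∧ Irreducible F₁ ∧ F₁.natDegree = n - 1 ∧
          F₂.Monic ∧ Irreducible F₂ ∧ F₂.natDegree = n ∧
          F.map (algebraMap Fq K) = F₁ + F₂ := by
  obtain rfl | ⟨e, rfl⟩ : n = 2 ∨ ∃ e, n = e + 3 := by
    obtain h | h := hn.eq_or_lt
    · exact .inl h.symm
    · exact .inr ⟨n - 3, by omega⟩
  · refine ⟨0, fun s _ K _ _ _ hK => ?_⟩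
    have hK2 : ringChar K ≠ 2 := fun h => by
      have := FiniteField.even_card_of_char_two h
      rw [hK] at this
      exact Nat.not_odd_iff_even.2 (Nat.even_iff.2 this) hodd.pow
    exact Goldbach.exists_goldbach_of_natDegree_eq_two hK2 (hF.map _)
      (by rw [natDegree_map, hdeg])
  have hcard : 2 < Fintype.card Fq := by
    have := Fintype.one_lt_card (α := Fq)
    obtain ⟨m, hm⟩ := hodd
    omega
  let k := AlgebraicClosure Fq
  have h2 : (2 : k) ≠ 0 := by
    have h : (2 : Fq) ≠ 0 := Ring.two_ne_zero fun h =>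
      Nat.not_odd_iff_even.2 (Nat.even_iff.2 (FiniteField.even_card_of_char_two h)) hodd
    have h := (map_ne_zero (algebraMap Fq k)).2 h
    rwa [map_ofNat] at h
  have hFk : (F.map (algebraMap Fq k)).Monic := hF.map _
  have hFkdeg : (F.map (algebraMap Fq k)).natDegree = e + 3 := by rw [natDegree_map, hdeg]
  obtain ⟨A, a, hA, hAdeg, hAa⟩ := Goldbach.exists_doubleRoot_sub h2 hFk hFkdeg
  obtain rfl | ⟨d, rfl⟩ : e = 0 ∨ ∃ d, e = d + 1 := by
    cases e <;> simp
  · exact Goldbach.exists_goldbach (a' := 0) hcard hF one_ne_zero hdeg hA hAdeg hA hAdeg hAa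
      (.inl rfl)
  · obtain ⟨D, a', hD, hDdeg, hDa⟩ := Goldbach.exists_sub_doubleRoot h2 hFk hFkdeg
    exact Goldbach.exists_goldbach hcard hF (Nat.succ_ne_zero _) hdeg hA hAdeg hD hDdeg hAa
      (.inr hDa)
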